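/- arXiv:0907.0141 — 2 statements merged into one kernel-verified Lean document; each statement's English description precedes it below -/
import Mathlib

section
/- Let p be a prime and ψ : ℕ → ℝ a non-negative function with Σ_{n∈ℕ} μ_p(E_n(ψ)) = ∞. If Σ_{n∈ℕ, ψ(n) ≥ 1/n} μ_p(E_n(ψ)) = ∞, then μ_p(W_p(ψ)) = 1. -/
open MeasureTheory Filter

noncomputable section

/-- The set `E_n(ψ) ⊆ ℤ_p`: union over integers `a` with `|a| ≤ n`, `gcd(a,n) = 1`
of the closed balls `{x : |x - a/n|_p ≤ ψ(n)}`. -/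
def padicE (p : ℕ) [Fact p.Prime] (ψ : ℕ → ℝ) (n : ℕ) : Set ℤ_[p] :=
  {x | ∃ a : ℤ, |a| ≤ (n : ℤ) ∧ Int.gcd a n = 1 ∧
    ‖(x : ℚ_[p]) - (a : ℚ_[p]) / (n : ℚ_[p])‖ ≤ ψ n}

/-- `W_p(ψ)`: the points of `ℤ_p` lying in infinitely many of the sets `E_n(ψ)`. -/
def padicW (p : ℕ) [Fact p.Prime] (ψ : ℕ → ℝ) : Set ℤ_[p] :=
  {x | {n : ℕ | x ∈ padicE p ψ n}.Infinite}

section NumberTheory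

open Finset

theorem sieve_count {δ : ℝ} (Y : ℕ) (B : ℕ → Finset ℕ) (S : Finset ℕ)
    (hS : ∀ q ∈ S, q.Prime) (hB : ∀ q ∈ S, B q ⊆ range q) :
    ∀ P : ℕ, (∀ q ∈ S, Nat.Coprime P q) →
      (∀ Q, Q ∣ P * ∏ q ∈ S, q → ∀ s,
        |(#{t ∈ range Y | t ≡ s [MOD Q]} : ℝ) - Y / Q| ≤ δ) →
      ∀ s, |(#{t ∈ range Y | t ≡ s [MOD P] ∧ ∀ q ∈ S, t % q ∉ B q} : ℝ)
          - Y / P * ∏ q ∈ S, (1 - (#(B q) : ℝ) / q)| ≤ δ * ∏ q ∈ S, (1 + (#(B q) : ℝ)) := by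
  induction S using Finset.induction_on with
  | empty =>
    intro P _ h s
    simpa using h P (by simp) s
  | insert q S hqS ih =>
    intro P hP h s
    have ih' := ih (fun r hr => hS r (mem_insert_of_mem hr)) (fun r hr => hB r (mem_insert_of_mem hr))
    have hq := hS q (mem_insert_self _ _)
    have hPq := hP q (mem_insert_self _ _)
    have h1 := ih' P (fun r hr => hP r (mem_insert_of_mem hr)) (fun Q hQ => h Q
      (hQ.trans (mul_dvd_mul_left _ (by rw [prod_insert hqS]; exact dvd_mul_left _ _)))) s
    have h2 := ih' (P * q) (fun r hr => Nat.Coprime.mul_left (hP r (mem_insert_of_mem hr))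
        ((Nat.coprime_primes hq (hS r (mem_insert_of_mem hr))).2 (by rintro rfl; exact hqS hr)))
      (fun Q hQ => h Q (by rwa [prod_insert hqS, ← mul_assoc]))
    have key : #{t ∈ range Y | t ≡ s [MOD P] ∧ ∀ r ∈ S, t % r ∉ B r}
        = #{t ∈ range Y | t ≡ s [MOD P] ∧ ∀ r ∈ insert q S, t % r ∉ B r}
          + ∑ β ∈ B q, #{t ∈ range Y | t ≡ (Nat.chineseRemainder hPq s β : ℕ) [MOD P * q] ∧
              ∀ r ∈ S, t % r ∉ B r} := by
      rw [← card_filter_add_card_filter_not (fun t => t % q ∉ B q), filter_filter, filter_filter]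
      congr 1
      · congr 1
        ext t
        simp only [mem_filter, mem_insert, forall_eq_or_imp]
        tauto
      · rw [← card_biUnion]
        · congr 1
          ext t
          simp only [mem_filter, mem_biUnion, not_not]
          constructor
          · rintro ⟨ht, ⟨h3, h4⟩, h5⟩
            refine ⟨t % q, h5, ht, ?_, h4⟩
            exact Nat.chineseRemainder_modEq_unique hPq h3 (Nat.mod_modEq t q).symm
          · rintro ⟨β, hβ, ht, h3, h4⟩
            have hc := (Nat.chineseRemainder hPq s β).2
            have h5 := (Nat.modEq_and_modEq_iff_modEq_mul hPq).2 h3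
            refine ⟨ht, ⟨h5.1.trans hc.1, h4⟩, ?_⟩
            have h6 : t % q = β % q := h5.2.trans hc.2
            rwa [h6, Nat.mod_eq_of_lt (mem_range.1 (hB q (mem_insert_self _ _) hβ))]
        · intro β hβ γ hγ hne
          rw [Function.onFun, disjoint_left]
          intro t ht ht'
          simp only [mem_filter] at ht ht'
          apply hne
          have h5 := (Nat.modEq_and_modEq_iff_modEq_mul hPq).2 ht.2.1
          have h6 := (Nat.modEq_and_modEq_iff_modEq_mul hPq).2 ht'.2.1
          have h7 := h5.2.trans (Nat.chineseRemainder hPq s β).2.2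
          have h8 := h6.2.trans (Nat.chineseRemainder hPq s γ).2.2
          have := h7.symm.trans h8
          rwa [Nat.ModEq, Nat.mod_eq_of_lt (mem_range.1 (hB q (mem_insert_self _ _) hβ)),
            Nat.mod_eq_of_lt (mem_range.1 (hB q (mem_insert_self _ _) hγ))] at this
    have key' : (#{t ∈ range Y | t ≡ s [MOD P] ∧ ∀ r ∈ S, t % r ∉ B r} : ℝ)
        = #{t ∈ range Y | t ≡ s [MOD P] ∧ ∀ r ∈ insert q S, t % r ∉ B r}
          + ∑ β ∈ B q, (#{t ∈ range Y | t ≡ (Nat.chineseRemainder hPq s β : ℕ) [MOD P * q] ∧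
              ∀ r ∈ S, t % r ∉ B r} : ℝ) := by
      exact_mod_cast key
    set M := ∏ r ∈ S, (1 - (#(B r) : ℝ) / r)
    set E := ∏ r ∈ S, (1 + (#(B r) : ℝ))
    have h3 : |∑ β ∈ B q, ((#{t ∈ range Y | t ≡ (Nat.chineseRemainder hPq s β : ℕ) [MOD P * q] ∧
              ∀ r ∈ S, t % r ∉ B r} : ℝ) - Y / (P * q : ℕ) * M)| ≤ #(B q) * (δ * E) := by
      refine (abs_sum_le_sum_abs _ _).trans ?_
      refine (sum_le_card_nsmul _ _ _ fun β _ => h2 _).trans ?_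
      simp
    rw [sum_sub_distrib] at h3
    rw [prod_insert hqS, prod_insert hqS]
    have e1 : (#{t ∈ range Y | t ≡ s [MOD P] ∧ ∀ r ∈ insert q S, t % r ∉ B r} : ℝ)
        - Y / P * ((1 - (#(B q) : ℝ) / q) * M) =
        ((#{t ∈ range Y | t ≡ s [MOD P] ∧ ∀ r ∈ S, t % r ∉ B r} : ℝ) - Y / P * M)
        - (∑ β ∈ B q, (#{t ∈ range Y | t ≡ (Nat.chineseRemainder hPq s β : ℕ) [MOD P * q] ∧
              ∀ r ∈ S, t % r ∉ B r} : ℝ) - ∑ β ∈ B q, Y / (P * q : ℕ) * M) := by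
      rw [key']
      simp only [sum_const, nsmul_eq_mul]
      push_cast
      have := hq.ne_zero
      by_cases hP0 : P = 0
      · subst hP0; simp
      field_simp
      ring
    rw [e1]
    refine (abs_sub _ _).trans ?_
    nlinarith

theorem card_range_modEq_sub_le (Y Q : ℕ) (hQ : 0 < Q) (s : ℕ) :
    |(#{t ∈ range Y | t ≡ s [MOD Q]} : ℝ) - Y / Q| ≤ 1 := by
  have h := Nat.count_modEq_card Y hQ s
  rw [Nat.count_eq_card_filter_range] at h
  rw [h]
  have h1 : (Y : ℝ) / Q = (Y / Q : ℕ) + (Y % Q : ℕ) / Q := by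
    have := Nat.div_add_mod Y Q
    field_simp
    exact_mod_cast this.symm
  have h2 : ((Y % Q : ℕ) : ℝ) / Q < 1 := by
    rw [div_lt_one (by positivity)]; exact_mod_cast Nat.mod_lt _ hQ
  have h3 : (0:ℝ) ≤ ((Y % Q : ℕ) : ℝ) / Q := by positivity
  rw [h1, abs_le]
  push_cast
  split_ifs <;> constructor <;> simp <;> linarith

theorem card_range_modEq_of_dvd (Y Q : ℕ) (hY : 0 < Y) (hQ : Q ∣ Y) (s : ℕ) :
    (#{t ∈ range Y | t ≡ s [MOD Q]} : ℝ) = Y / Q := by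
  have hQ0 := Nat.pos_of_dvd_of_pos hQ hY
  have h := Nat.count_modEq_card Y hQ0 s
  rw [Nat.count_eq_card_filter_range] at h
  rw [h, Nat.mod_eq_zero_of_dvd hQ]
  simp [Nat.cast_div hQ (by positivity : (Q:ℝ) ≠ 0)]

/-- The ratio `φ(n) / n`, as a product over the primes dividing `n`. -/
def totientRatio (n : ℕ) : ℝ := ∏ q ∈ n.primeFactors, (1 - (q : ℝ)⁻¹)

theorem half_le_one_sub_inv {q : ℕ} (hq : q.Prime) : (1 / 2 : ℝ) ≤ 1 - (q : ℝ)⁻¹ := by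
  have h : (2 : ℝ) ≤ q := by exact_mod_cast hq.two_le
  have : (q : ℝ)⁻¹ ≤ 2⁻¹ := inv_anti₀ (by norm_num) h
  linarith

theorem one_sub_inv_pos {q : ℕ} (hq : q.Prime) : (0 : ℝ) < 1 - (q : ℝ)⁻¹ := by
  linarith [half_le_one_sub_inv hq]

theorem one_sub_inv_le_one (q : ℕ) : 1 - (q : ℝ)⁻¹ ≤ 1 := by
  have : (0 : ℝ) ≤ (q : ℝ)⁻¹ := by positivity
  linarith

theorem totientRatio_pos (n : ℕ) : 0 < totientRatio n :=
  prod_pos fun _ hq => one_sub_inv_pos (Nat.prime_of_mem_primeFactors hq)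

theorem totient_eq_mul_totientRatio (n : ℕ) : (n.totient : ℝ) = n * totientRatio n := by
  have := congrArg (Rat.cast : ℚ → ℝ) (Nat.totient_eq_mul_prod_factors n)
  push_cast at this
  exact this

theorem one_le_two_pow_mul_totientRatio (n : ℕ) :
    1 ≤ 2 ^ #n.primeFactors * totientRatio n := by
  rw [totientRatio, ← prod_const, ← prod_mul_distrib]
  have : ∏ _q ∈ n.primeFactors, (1 : ℝ) ≤ ∏ q ∈ n.primeFactors, 2 * (1 - (q : ℝ)⁻¹) := by
    refine prod_le_prod (by simp) fun q hq => ?_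
    linarith [half_le_one_sub_inv (Nat.prime_of_mem_primeFactors hq)]
  simpa using this

theorem four_pow_card_primeFactors_pow_le :
    ∃ K : ℝ, 0 < K ∧ ∀ n : ℕ, 0 < n → ((4 : ℝ) ^ #n.primeFactors) ^ 4 ≤ K * n := by
  refine ⟨256 ^ 256, by positivity, fun n hn => ?_⟩
  have h1 : ((4 : ℝ) ^ #n.primeFactors) ^ 4 = 256 ^ #n.primeFactors := by
    rw [← pow_mul, mul_comm, pow_mul]; norm_num
  rw [h1, ← card_filter_add_card_filter_not (fun q => q < 256), pow_add]
  gcongr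
  · norm_num
  · refine (card_le_card (t := range 256) fun q hq => ?_).trans (card_range _).le
    exact mem_range.2 (mem_filter.1 hq).2
  · rw [← prod_const]
    calc ∏ _q ∈ n.primeFactors with ¬ _q < 256, (256 : ℝ)
        ≤ ∏ q ∈ n.primeFactors with ¬ q < 256, (q : ℝ) := by
          refine prod_le_prod (by simp) fun q hq => ?_
          exact_mod_cast not_lt.1 (mem_filter.1 hq).2
      _ ≤ ∏ q ∈ n.primeFactors, (q : ℝ) := by
          refine prod_le_prod_of_subset_of_one_le (filter_subset _ _) (by simp) fun q hq _ => ?_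
          exact_mod_cast (Nat.prime_of_mem_primeFactors hq).one_le
      _ ≤ n := by
          rw [← Nat.cast_prod]
          exact_mod_cast Nat.le_of_dvd hn (Nat.prod_primeFactors_dvd n)

theorem prod_one_add_inv_sqrt_le (n : ℕ) (hn : n ≠ 0) :
    ∏ q ∈ n.primeFactors, (1 + (√(q : ℝ))⁻¹) ≤ ∑ d ∈ n.divisors, (√(d : ℝ))⁻¹ := by
  calc ∏ q ∈ n.primeFactors, (1 + (√(q : ℝ))⁻¹)
      = ∑ d ∈ n.divisors with Squarefree d, (√(d : ℝ))⁻¹ := by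
        rw [prod_one_add, Nat.sum_divisors_filter_squarefree hn]
        refine sum_congr ?_ fun S _ => ?_
        · rw [Nat.factors_eq]; rfl
        rw [prod_inv_distrib]
        congr 1
        rw [← Real.sqrt_prod _ (by simp)]
        push_cast
        simp
    _ ≤ _ := sum_le_sum_of_subset_of_nonneg (filter_subset _ _) fun _ _ _ => by positivity

theorem inv_totientRatio_le (n : ℕ) (hn : n ≠ 0) :
    (totientRatio n)⁻¹ ≤ 2 * ∑ d ∈ n.divisors, (√(d : ℝ))⁻¹ := by
  refine le_trans ?_ (mul_le_mul_of_nonneg_left (prod_one_add_inv_sqrt_le n hn) zero_le_two)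
  have h2 : ∀ q : ℕ, q.Prime → q ≠ 2 → (1 - (q : ℝ)⁻¹)⁻¹ ≤ 1 + (√(q : ℝ))⁻¹ := by
    intro q hq hq2
    have h3 : (3 : ℝ) ≤ q := by exact_mod_cast lt_of_le_of_ne hq.two_le hq2.symm
    have hs : (1.7 : ℝ) ≤ √q := Real.le_sqrt_of_sq_le (by norm_num; linarith)
    have hsq : √(q : ℝ) ^ 2 = q := Real.sq_sqrt (by positivity)
    rw [inv_le_iff_one_le_mul₀ (one_sub_inv_pos hq)]
    nth_rw 2 [← hsq]
    have : 0 < √(q : ℝ) := by linarith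
    field_simp
    nlinarith
  rw [totientRatio, ← prod_inv_distrib]
  by_cases hmem : 2 ∈ n.primeFactors
  · rw [← mul_prod_erase _ _ hmem, ← mul_prod_erase _ _ hmem, ← mul_assoc]
    have h1 : ∏ q ∈ n.primeFactors.erase 2, (1 - (q : ℝ)⁻¹)⁻¹
        ≤ ∏ q ∈ n.primeFactors.erase 2, (1 + (√(q : ℝ))⁻¹) :=
      prod_le_prod (fun q hq => (inv_pos.2 (one_sub_inv_pos
        (Nat.prime_of_mem_primeFactors (mem_of_mem_erase hq)))).le)
        fun q hq => h2 q (Nat.prime_of_mem_primeFactors (mem_of_mem_erase hq)) (ne_of_mem_erase hq)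
    refine mul_le_mul ?_ h1 (prod_nonneg fun q hq => (inv_pos.2 (one_sub_inv_pos
        (Nat.prime_of_mem_primeFactors (mem_of_mem_erase hq)))).le) (by positivity)
    have : (0 : ℝ) ≤ (√((2 : ℕ) : ℝ))⁻¹ := by positivity
    norm_num at this ⊢
  · have h1 : ∏ q ∈ n.primeFactors, (1 - (q : ℝ)⁻¹)⁻¹
        ≤ ∏ q ∈ n.primeFactors, (1 + (√(q : ℝ))⁻¹) :=
      prod_le_prod (fun q hq => (inv_pos.2 (one_sub_inv_pos
        (Nat.prime_of_mem_primeFactors hq))).le)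
        fun q hq => h2 q (Nat.prime_of_mem_primeFactors hq) (by rintro rfl; exact hmem hq)
    have : 0 ≤ ∏ q ∈ n.primeFactors, (1 + (√(q : ℝ))⁻¹) := by positivity
    linarith

theorem card_coprime_modEq_sub_le (Y N P : ℕ) (hN : 0 < N) (hP : 0 < P) (hPN : P.Coprime N)
    (s : ℕ) :
    |(#{b ∈ range Y | b ≡ s [MOD P] ∧ b.Coprime N} : ℝ) - Y / P * totientRatio N|
      ≤ 2 ^ #N.primeFactors := by
  have h := sieve_count (δ := 1) Y (fun _ => {0}) N.primeFactors
    (fun q hq => Nat.prime_of_mem_primeFactors hq)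
    (fun q hq => by simpa using (Nat.prime_of_mem_primeFactors hq).pos) P
    (fun q hq => hPN.coprime_dvd_right (Nat.dvd_of_mem_primeFactors hq))
    (fun Q hQ s => card_range_modEq_sub_le Y Q (Nat.pos_of_dvd_of_pos hQ (Nat.mul_pos hP
      (prod_pos fun q hq => (Nat.prime_of_mem_primeFactors hq).pos))) s) s
  have e : ∀ b : ℕ, (∀ q ∈ N.primeFactors, b % q ∉ ({0} : Finset ℕ)) ↔ b.Coprime N := by
    intro b
    simp only [mem_singleton, ← Nat.dvd_iff_mod_eq_zero]
    refine ⟨fun hb => Nat.coprime_of_dvd fun q hq hqb hqN =>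
      hb q (Nat.mem_primeFactors.2 ⟨hq, hqN, hN.ne'⟩) hqb, fun hb q hq hqb => ?_⟩
    exact Nat.not_coprime_of_dvd_of_dvd (Nat.prime_of_mem_primeFactors hq).one_lt hqb
      (Nat.dvd_of_mem_primeFactors hq) hb
  simp only [e] at h
  convert h using 2
  · simp [totientRatio]
  · norm_num

theorem sum_inv_sqrt_le (M : ℕ) : ∑ d ∈ Icc 1 M, (√(d : ℝ))⁻¹ ≤ 2 * √M := by
  induction M with
  | zero => simp
  | succ M ih =>
    rw [sum_Icc_succ_top (by omega)]
    have hs : 0 < √((M + 1 : ℕ) : ℝ) := Real.sqrt_pos.2 (by positivity)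
    have h0 : 0 ≤ √(M : ℝ) := by positivity
    have h1 : √((M + 1 : ℕ) : ℝ) ^ 2 = M + 1 := by rw [Real.sq_sqrt (by positivity)]; push_cast; rfl
    have h2 : √(M : ℝ) ^ 2 = M := Real.sq_sqrt (by positivity)
    have h3 : (√((M + 1 : ℕ) : ℝ))⁻¹ ≤ 2 * √((M + 1 : ℕ) : ℝ) - 2 * √(M : ℝ) := by
      rw [inv_le_iff_one_le_mul₀ hs]
      nlinarith [sq_nonneg (√((M + 1 : ℕ) : ℝ) - √(M : ℝ))]
    linarith

theorem sum_inv_totientRatio_coprime_le (M N : ℕ) (hN : 0 < N) :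
    ∑ c ∈ Icc 1 M with c.Coprime N, (totientRatio c)⁻¹ ≤
      2 * ((M + 1) * totientRatio N * ∑' d : ℕ, ((d : ℝ) * √d)⁻¹
        + 2 ^ #N.primeFactors * (2 * √M)) := by
  have hsum : Summable fun d : ℕ => ((d : ℝ) * √d)⁻¹ := by
    refine (Real.summable_nat_rpow_inv.2 (by norm_num : (1 : ℝ) < 3 / 2)).congr fun d => ?_
    rw [Real.sqrt_eq_rpow]
    rcases Nat.eq_zero_or_pos d with rfl | hd
    · norm_num
    · rw [← Real.rpow_one_add' (by positivity) (by norm_num)]; norm_num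
  calc ∑ c ∈ Icc 1 M with c.Coprime N, (totientRatio c)⁻¹
      ≤ ∑ c ∈ Icc 1 M with c.Coprime N, 2 * ∑ d ∈ Icc 1 M with d ∣ c, (√(d : ℝ))⁻¹ := by
        refine sum_le_sum fun c hc => ?_
        simp only [mem_filter, mem_Icc] at hc
        refine (inv_totientRatio_le c (by omega)).trans (le_of_eq ?_)
        congr 1
        refine sum_congr ?_ fun _ _ => rfl
        ext d
        simp only [Nat.mem_divisors, mem_filter, mem_Icc]
        constructor
        · rintro ⟨h, _⟩
          exact ⟨⟨Nat.pos_of_dvd_of_pos h (by omega), (Nat.le_of_dvd (by omega) h).trans hc.1.2⟩, h⟩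
        · rintro ⟨_, h⟩
          exact ⟨h, by omega⟩
    _ = 2 * ∑ d ∈ Icc 1 M, (√(d : ℝ))⁻¹ * #{c ∈ Icc 1 M | d ∣ c ∧ c.Coprime N} := by
        rw [← mul_sum]
        congr 1
        simp only [sum_filter]
        simp only [card_eq_sum_ones, Nat.cast_sum, mul_sum, sum_filter]
        have : ∀ c d : ℕ, (if c.Coprime N then (if d ∣ c then (√(d : ℝ))⁻¹ else 0) else 0)
          = if d ∣ c ∧ c.Coprime N then (√(d : ℝ))⁻¹ else 0 := by
          intro c d; split_ifs <;> simp_all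
        rw [sum_congr rfl fun c _ => (show _ = ∑ d ∈ Icc 1 M, if d ∣ c ∧ c.Coprime N then
          (√(d : ℝ))⁻¹ else 0 from ?_), sum_comm]
        · simp
        · rw [← sum_congr rfl fun d _ => this c d]
          split_ifs <;> simp
    _ ≤ 2 * ∑ d ∈ Icc 1 M, ((M + 1) * totientRatio N * ((d : ℝ) * √d)⁻¹
          + 2 ^ #N.primeFactors * (√(d : ℝ))⁻¹) := by
        gcongr with d hd
        simp only [mem_Icc] at hd
        have hd0 : (0 : ℝ) < d := by exact_mod_cast hd.1
        have hcard : (#{c ∈ Icc 1 M | d ∣ c ∧ c.Coprime N} : ℝ)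
            ≤ (M + 1) / d * totientRatio N + 2 ^ #N.primeFactors := by
          by_cases hdN : d.Coprime N
          · have h := (abs_le.1 (card_coprime_modEq_sub_le (M + 1) N d hN hd.1 hdN 0)).2
            have h' : (#{c ∈ Icc 1 M | d ∣ c ∧ c.Coprime N} : ℝ)
                ≤ #{b ∈ range (M + 1) | b ≡ 0 [MOD d] ∧ b.Coprime N} := by
              norm_cast
              refine card_le_card fun c hc => ?_
              simp only [mem_filter, mem_Icc, mem_range, Nat.modEq_zero_iff_dvd] at hc ⊢
              exact ⟨by omega, hc.2⟩
            push_cast at h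
            linarith
          · have : #{c ∈ Icc 1 M | d ∣ c ∧ c.Coprime N} = 0 := by
              rw [card_eq_zero, filter_eq_empty_iff]
              rintro c _ ⟨h, h'⟩
              exact hdN (h'.coprime_dvd_left h)
            rw [this]
            have := totientRatio_pos N
            rw [Nat.cast_zero]
            positivity
        calc _ ≤ (√(d : ℝ))⁻¹ * ((M + 1) / d * totientRatio N + 2 ^ #N.primeFactors) := by gcongr
          _ = _ := by rw [mul_inv]; ring
    _ ≤ _ := by
        rw [sum_add_distrib, ← mul_sum, ← mul_sum]
        have := totientRatio_pos N
        gcongr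
        · exact hsum.sum_le_tsum _ fun _ _ => by positivity
        · exact sum_inv_sqrt_le M

theorem exists_sum_inv_totientRatio_le (p : ℝ) (hp : 0 < p) :
    ∃ C : ℝ, 0 < C ∧ ∀ (N : ℕ) (X : ℝ), 0 < N → 0 ≤ X → (N : ℝ) ≤ (p * X) ^ 2 →
      ∑ c ∈ Icc 1 ⌊X⌋₊ with c.Coprime N, (totientRatio c)⁻¹ ≤ C * (X * totientRatio N) := by
  obtain ⟨K, hK, hKn⟩ := four_pow_card_primeFactors_pow_le
  set Z := ∑' d : ℕ, ((d : ℝ) * √d)⁻¹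
  have hZ : 0 ≤ Z := tsum_nonneg fun _ => by positivity
  set K' := √(√(K * p ^ 2)) with hK'
  refine ⟨4 * Z + 4 * K' + 1, by positivity, fun N X hN hX hNX => ?_⟩
  have hρ := totientRatio_pos N
  by_cases hX1 : X < 1
  · rw [Nat.floor_eq_zero.2 hX1]
    simpa using by positivity
  push Not at hX1
  have hM : (⌊X⌋₊ : ℝ) ≤ X := Nat.floor_le hX
  refine (sum_inv_totientRatio_coprime_le ⌊X⌋₊ N hN).trans ?_
  have h1 : ((⌊X⌋₊ : ℝ) + 1) * totientRatio N * Z ≤ 2 * X * totientRatio N * Z := by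
    gcongr; linarith
  have h4 : (4 : ℝ) ^ #N.primeFactors ≤ K' * √X := by
    have e : K' * √X = √√(K * (p * X) ^ 2) := by
      rw [hK', mul_pow, ← mul_assoc, Real.sqrt_mul (x := K * p ^ 2) (by positivity), Real.sqrt_sq hX,
        Real.sqrt_mul (Real.sqrt_nonneg _)]
    rw [e]
    refine Real.le_sqrt_of_sq_le (Real.le_sqrt_of_sq_le ?_)
    rw [← pow_mul]
    exact (hKn N hN).trans (by gcongr)
  have h2 : (2 : ℝ) ^ #N.primeFactors ≤ 4 ^ #N.primeFactors * totientRatio N := by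
    have := one_le_two_pow_mul_totientRatio N
    have e : (4 : ℝ) ^ #N.primeFactors = 2 ^ #N.primeFactors * 2 ^ #N.primeFactors := by
      rw [← mul_pow]; norm_num
    rw [e, mul_assoc]
    exact le_mul_of_one_le_right (by positivity) this
  have h5 : √(⌊X⌋₊ : ℝ) ≤ √X := Real.sqrt_le_sqrt hM
  have h3 : (2 : ℝ) ^ #N.primeFactors * (2 * √(⌊X⌋₊ : ℝ)) ≤ 2 * K' * X * totientRatio N := by
    calc _ ≤ (K' * √X * totientRatio N) * (2 * √X) := by gcongr; exact h2.trans (by gcongr)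
      _ = 2 * K' * (√X * √X) * totientRatio N := by ring
      _ = _ := by rw [Real.mul_self_sqrt hX]
  nlinarith [mul_nonneg hX hρ.le]

theorem exists_lt_dvd_add_mul {q : ℕ} (hq : q.Prime) {m : ℕ} (hm : ¬ q ∣ m) (r : ℤ) :
    ∃ x ∈ range q, (q : ℤ) ∣ r + m * x := by
  have : Fact q.Prime := ⟨hq⟩
  have hm' : (m : ZMod q) ≠ 0 := by rwa [Ne, ZMod.natCast_eq_zero_iff]
  refine ⟨(-(r : ZMod q) / m).val, mem_range.2 (ZMod.val_lt _), ?_⟩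
  rw [← ZMod.intCast_zmod_eq_zero_iff_dvd]
  push_cast
  rw [ZMod.natCast_zmod_val]
  field_simp
  ring

theorem card_reduced_pairs_eq_le {g m n c P : ℕ} (hg : 0 < g) (hm : 0 < m) (hmn : m.Coprime n)
    (hP : P.Coprime g) :
    (#{x ∈ range (g * m) ×ˢ range (g * n) | x.1.Coprime (g * m) ∧ x.2.Coprime (g * n) ∧
      x.1 * n = x.2 * m + c * P} : ℝ) ≤
    g * totientRatio g *
      ∏ q ∈ g.primeFactors with ¬ q ∣ m * n ∧ ¬ q ∣ c, (1 - (q : ℝ)⁻¹) := by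
  classical
  have hnn : 0 ≤ g * totientRatio g *
      ∏ q ∈ g.primeFactors with ¬ q ∣ m * n ∧ ¬ q ∣ c, (1 - (q : ℝ)⁻¹) :=
    mul_nonneg (mul_nonneg (by positivity) (totientRatio_pos g).le) (prod_nonneg fun q hq =>
      (one_sub_inv_pos (Nat.prime_of_mem_primeFactors (mem_filter.1 hq).1)).le)
  rcases (filter (fun x : ℕ × ℕ => x.1.Coprime (g * m) ∧ x.2.Coprime (g * n) ∧
      x.1 * n = x.2 * m + c * P) (range (g * m) ×ˢ range (g * n))).eq_empty_or_nonempty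
      with h0 | ⟨⟨a₁, b₁⟩, h1⟩
  · rw [h0]; simpa using hnn
  simp only [mem_filter, mem_product, mem_range] at h1
  obtain ⟨-, -, -, h1⟩ := h1
  set r : ℤ := a₁ % m with hr
  set β : ℤ := b₁ - n * (a₁ / m : ℕ) with hβ
  have hrβ : (n : ℤ) * r - m * β = c * P := by
    have h2 : (a₁ : ℤ) = r + m * (a₁ / m : ℕ) := by
      rw [hr]; exact_mod_cast (Nat.mod_add_div a₁ m).symm
    have h3 : (a₁ : ℤ) * n = b₁ * m + c * P := by exact_mod_cast h1
    rw [hβ]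
    linear_combination h3 - n * h2
  set B : ℕ → Finset ℕ := fun q =>
    {x ∈ range q | (q : ℤ) ∣ r + m * (x : ℕ) ∨ (q : ℤ) ∣ β + n * (x : ℕ)} with hB
  have hparam : ∀ a b : ℕ, a * n = b * m + c * P →
      (a : ℤ) = r + m * (a / m : ℕ) ∧ (b : ℤ) = β + n * (a / m : ℕ) := by
    intro a b hab
    have h3 : (a : ℤ) * n = b * m + c * P := by exact_mod_cast hab
    have h4 : (a₁ : ℤ) * n = b₁ * m + c * P := by exact_mod_cast h1
    have h5 : (m : ℤ) ∣ a - a₁ := by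
      refine (Nat.isCoprime_iff_coprime.2 hmn).dvd_of_dvd_mul_right (y := (a : ℤ) - a₁) ⟨b - b₁, ?_⟩
      linear_combination h3 - h4
    have h6 : (a : ℤ) % m = r :=
      Int.emod_eq_emod_iff_emod_sub_eq_zero.2 (Int.emod_eq_zero_of_dvd h5)
    have h7 : (a : ℤ) = r + m * (a / m : ℕ) := by
      rw [← h6]; exact_mod_cast (Nat.mod_add_div a m).symm
    refine ⟨h7, ?_⟩
    have hm0 : (m : ℤ) ≠ 0 := by exact_mod_cast hm.ne'
    apply mul_right_cancel₀ hm0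
    linear_combination n * h7 + hrβ - h3
  have hcard : #{x ∈ range (g * m) ×ˢ range (g * n) | x.1.Coprime (g * m) ∧ x.2.Coprime (g * n) ∧
      x.1 * n = x.2 * m + c * P} ≤
      #{t ∈ range g | t ≡ 0 [MOD 1] ∧ ∀ q ∈ g.primeFactors, t % q ∉ B q} := by
    refine card_le_card_of_injOn (fun x => x.1 / m) ?_ ?_
    · rintro ⟨a, b⟩ hx
      simp only [coe_filter, mem_product, mem_range, Set.mem_ofPred_eq] at hx ⊢
      obtain ⟨⟨ha, hb⟩, hca, hcb, hab⟩ := hx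
      obtain ⟨h2, h3⟩ := hparam a b hab
      refine ⟨(Nat.div_lt_iff_lt_mul hm).2 ha, Nat.modEq_one, fun q hq hmem => ?_⟩
      have hqp := Nat.prime_of_mem_primeFactors hq
      have hqg := Nat.dvd_of_mem_primeFactors hq
      have hmod : (q : ℤ) ∣ ((a / m : ℕ) : ℤ) - ((a / m % q : ℕ) : ℤ) := by
        push_cast
        exact Int.dvd_self_sub_emod
      rcases (mem_filter.1 hmem).2 with h4 | h4
      · have : (q : ℤ) ∣ a := by
          rw [h2]
          obtain ⟨k, hk⟩ := h4
          obtain ⟨l, hl⟩ := hmod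
          exact ⟨k + m * l, by linear_combination hk + m * hl⟩
        exact Nat.not_coprime_of_dvd_of_dvd hqp.one_lt (Int.natCast_dvd_natCast.1 this)
          (hqg.mul_right m) hca
      · have : (q : ℤ) ∣ b := by
          rw [h3]
          obtain ⟨k, hk⟩ := h4
          obtain ⟨l, hl⟩ := hmod
          exact ⟨k + n * l, by linear_combination hk + n * hl⟩
        exact Nat.not_coprime_of_dvd_of_dvd hqp.one_lt (Int.natCast_dvd_natCast.1 this)
          (hqg.mul_right n) hcb
    · rintro ⟨a, b⟩ hx ⟨a', b'⟩ hx' heq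
      simp only [coe_filter, mem_product, mem_range, Set.mem_ofPred_eq] at hx hx' heq
      obtain ⟨h2, h3⟩ := hparam a b hx.2.2.2
      obtain ⟨h4, h5⟩ := hparam a' b' hx'.2.2.2
      rw [heq] at h2 h3
      ext
      · exact_mod_cast h2.trans h4.symm
      · exact_mod_cast h3.trans h5.symm
  have hsieve := sieve_count (δ := 0) g B g.primeFactors
    (fun q hq => Nat.prime_of_mem_primeFactors hq) (fun q _ => filter_subset _ _) 1
    (fun q _ => Nat.coprime_one_left q)
    (fun Q hQ s => by
      rw [card_range_modEq_of_dvd g Q hg ((one_mul (∏ q ∈ g.primeFactors, q) ▸ hQ).trans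
        (Nat.prod_primeFactors_dvd g))]
      simp) 0
  rw [zero_mul] at hsieve
  have hsieve' := sub_eq_zero.1 (abs_nonpos_iff.1 hsieve)
  have hlocal : ∀ q ∈ g.primeFactors, 1 - (#(B q) : ℝ) / q ≤
      (1 - (q : ℝ)⁻¹) * (if ¬ q ∣ m * n ∧ ¬ q ∣ c then (1 - (q : ℝ)⁻¹) else 1) := by
    intro q hq
    have hqp := Nat.prime_of_mem_primeFactors hq
    have hq0 : (0 : ℝ) < q := by exact_mod_cast hqp.pos
    have hqP : ¬ q ∣ P := fun h => Nat.not_coprime_of_dvd_of_dvd hqp.one_lt h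
      (Nat.dvd_of_mem_primeFactors hq) hP
    split_ifs with hqc
    · rw [hqp.dvd_mul, not_or] at hqc
      obtain ⟨⟨hqm, hqn⟩, hqc⟩ := hqc
      obtain ⟨x, hx, hxm⟩ := exists_lt_dvd_add_mul hqp hqm r
      obtain ⟨y, hy, hyn⟩ := exists_lt_dvd_add_mul hqp hqn β
      have hxy : x ≠ y := by
        rintro rfl
        have h3 : (q : ℤ) ∣ c * P := by
          obtain ⟨k, hk⟩ := hxm
          obtain ⟨l, hl⟩ := hyn
          exact ⟨n * k - m * l, by linear_combination n * hk - m * hl - hrβ⟩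
        exact ((hqp.dvd_mul).1 (by exact_mod_cast h3)).elim hqc hqP
      have hcard2 : 2 ≤ #(B q) := by
        rw [← card_pair hxy]
        refine card_le_card ?_
        simp only [insert_subset_iff, singleton_subset_iff, hB, mem_filter]
        exact ⟨⟨hx, Or.inl hxm⟩, hy, Or.inr hyn⟩
      have : (2 : ℝ) / q ≤ #(B q) / q := by gcongr; exact_mod_cast hcard2
      have e : (2 : ℝ) / q = 2 * (q : ℝ)⁻¹ := by ring
      nlinarith [sq_nonneg ((q : ℝ)⁻¹)]
    · have hcard1 : 1 ≤ #(B q) := by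
        rw [Nat.one_le_iff_ne_zero, card_ne_zero]
        by_cases hqm : q ∣ m
        · have hqn : ¬ q ∣ n := fun h => Nat.not_coprime_of_dvd_of_dvd hqp.one_lt hqm h hmn
          obtain ⟨y, hy, hyn⟩ := exists_lt_dvd_add_mul hqp hqn β
          exact ⟨y, mem_filter.2 ⟨hy, Or.inr hyn⟩⟩
        · obtain ⟨x, hx, hxm⟩ := exists_lt_dvd_add_mul hqp hqm r
          exact ⟨x, mem_filter.2 ⟨hx, Or.inl hxm⟩⟩
      have : (1 : ℝ) / q ≤ #(B q) / q := by gcongr; exact_mod_cast hcard1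
      rw [one_div] at this
      linarith
  have hprod : ∏ q ∈ g.primeFactors, (1 - (#(B q) : ℝ) / q) ≤ totientRatio g *
      ∏ q ∈ g.primeFactors with ¬ q ∣ m * n ∧ ¬ q ∣ c, (1 - (q : ℝ)⁻¹) := by
    rw [totientRatio, prod_filter, ← prod_mul_distrib]
    refine prod_le_prod (fun q hq => ?_) hlocal
    have hq0 : (0 : ℝ) < q := by exact_mod_cast (Nat.prime_of_mem_primeFactors hq).pos
    have : (#(B q) : ℝ) / q ≤ 1 := by
      rw [div_le_one hq0]
      exact_mod_cast (card_le_card (filter_subset _ _)).trans (card_range q).le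
    linarith
  calc _ ≤ (#{t ∈ range g | t ≡ 0 [MOD 1] ∧ ∀ q ∈ g.primeFactors, t % q ∉ B q} : ℝ) := by
        exact_mod_cast hcard
    _ = g * ∏ q ∈ g.primeFactors, (1 - (#(B q) : ℝ) / q) := by rw [hsieve']; simp
    _ ≤ _ := by rw [mul_assoc]; gcongr

theorem prod_not_dvd_le (g N : ℕ) {c : ℕ} (hc : c ≠ 0) :
    ∏ q ∈ g.primeFactors with ¬ q ∣ N ∧ ¬ q ∣ c, (1 - (q : ℝ)⁻¹) ≤
      (∏ q ∈ g.primeFactors with ¬ q ∣ N, (1 - (q : ℝ)⁻¹)) * (totientRatio c)⁻¹ := by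
  rw [← div_eq_mul_inv, le_div_iff₀ (totientRatio_pos c),
    ← prod_filter_mul_prod_filter_not (g.primeFactors.filter fun q => ¬ q ∣ N)
      (fun q => ¬ q ∣ c), filter_filter, filter_filter]
  have hpos : ∀ q ∈ g.primeFactors, 0 ≤ 1 - (q : ℝ)⁻¹ := fun q hq =>
    (one_sub_inv_pos (Nat.prime_of_mem_primeFactors hq)).le
  refine mul_le_mul_of_nonneg_left ?_ (prod_nonneg fun q hq => hpos q (mem_filter.1 hq).1)
  refine prod_le_prod_of_subset_of_le_one (fun q hq => ?_) (fun q hq =>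
    (one_sub_inv_pos (Nat.prime_of_mem_primeFactors hq)).le) fun _ _ _ => one_sub_inv_le_one _
  simp only [mem_filter, not_not] at hq
  exact Nat.mem_primeFactors.2 ⟨Nat.prime_of_mem_primeFactors hq.1, hq.2.2, hc⟩

theorem prod_not_dvd_mul_totientRatio {g N : ℕ} (hg : 0 < g) (hN : 0 < N) :
    (∏ q ∈ g.primeFactors with ¬ q ∣ N, (1 - (q : ℝ)⁻¹)) * totientRatio N
      = totientRatio (g * N) := by
  classical
  rw [totientRatio, totientRatio, ← prod_union]
  · refine prod_congr ?_ fun _ _ => rfl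
    ext q
    simp only [mem_union, mem_filter, Nat.mem_primeFactors, ne_eq, mul_eq_zero, not_or]
    constructor
    · rintro (⟨⟨h1, h2, h3⟩, h4⟩ | ⟨h1, h2, h3⟩)
      · exact ⟨h1, h2.mul_right _, h3, hN.ne'⟩
      · exact ⟨h1, h2.mul_left _, hg.ne', h3⟩
    · rintro ⟨h1, h2, h3, h4⟩
      have := (h1.dvd_mul).1 h2
      tauto
  · rw [disjoint_left]
    intro q hq hq'
    exact (mem_filter.1 hq).2 (Nat.dvd_of_mem_primeFactors hq')

theorem totient_mul_totient_eq {g m n : ℕ} (hg : 0 < g) (hm : 0 < m) (hn : 0 < n)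
    (hmn : m.Coprime n) :
    ((g * m).totient : ℝ) * (g * n).totient =
      (g * totientRatio g) * (g * (m * n) * totientRatio (g * (m * n))) := by
  have h := Nat.totient_gcd_mul_totient_mul (g * m) (g * n)
  rw [Nat.gcd_mul_left, hmn.gcd_eq_one, mul_one] at h
  have h' : (g.totient : ℝ) * ((g * m) * (g * n)).totient =
    (g * m).totient * (g * n).totient * g := by exact_mod_cast h
  rw [totient_eq_mul_totientRatio g, totient_eq_mul_totientRatio ((g * m) * (g * n))] at h'
  have e : totientRatio ((g * m) * (g * n)) = totientRatio (g * (m * n)) := by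
    rw [totientRatio, totientRatio]
    refine prod_congr ?_ fun _ _ => rfl
    rw [Nat.primeFactors_mul (by positivity) (by positivity),
      Nat.primeFactors_mul hg.ne' hm.ne', Nat.primeFactors_mul hg.ne' hn.ne',
      Nat.primeFactors_mul hg.ne' (by positivity), Nat.primeFactors_mul hm.ne' hn.ne']
    ext q; simp only [mem_union]; tauto
  rw [e] at h'
  have hg' : (g : ℝ) ≠ 0 := by positivity
  apply mul_right_cancel₀ hg'
  rw [← h']
  push_cast
  ring

theorem exists_card_reduced_pairs_lt_le (p : ℝ) (hp : 0 < p) :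
    ∃ C : ℝ, 0 < C ∧ ∀ m n P : ℕ, 0 < m → 0 < n → 0 < P → P.Coprime m →
      (P : ℝ) ≤ p * m → (P : ℝ) ≤ p * n →
      (#{x ∈ range m ×ˢ range n | x.1.Coprime m ∧ x.2.Coprime n ∧ x.2 * m < x.1 * n ∧
        x.2 * m ≡ x.1 * n [MOD P]} : ℝ) ≤ C * (m.totient * n.totient / P) := by
  classical
  obtain ⟨C, hC, hsum⟩ := exists_sum_inv_totientRatio_le p hp
  refine ⟨C, hC, fun m₀ n₀ P hm₀ hn₀ hP hPm₀ hPm hPn => ?_⟩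
  obtain ⟨g, m, n, hg, hmn, rfl, rfl⟩ : ∃ g m n : ℕ, 0 < g ∧ m.Coprime n ∧ m₀ = g * m ∧
      n₀ = g * n := by
    obtain ⟨m, n, h1, h2, h3⟩ := Nat.exists_coprime m₀ n₀
    exact ⟨m₀.gcd n₀, m, n, Nat.gcd_pos_of_pos_left _ hm₀, h1, by rw [mul_comm]; exact h2,
      by rw [mul_comm]; exact h3⟩
  have hm : 0 < m := Nat.pos_of_mul_pos_left hm₀
  have hn : 0 < n := Nat.pos_of_mul_pos_left hn₀
  have hPg : P.Coprime g := hPm₀.coprime_dvd_right (dvd_mul_right _ _)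
  set X : ℝ := g * (m * n) / P with hX
  set κ := ∏ q ∈ g.primeFactors with ¬ q ∣ m * n, (1 - (q : ℝ)⁻¹) with hκ
  have hκ0 : 0 ≤ κ := prod_nonneg fun q hq =>
    (one_sub_inv_pos (Nat.prime_of_mem_primeFactors (mem_filter.1 hq).1)).le
  have hP' : (0 : ℝ) < P := by exact_mod_cast hP
  have hNX : ((m * n : ℕ) : ℝ) ≤ (p * X) ^ 2 := by
    have h1 : (m : ℝ) ≤ p * X := by
      rw [hX, ← mul_div_assoc, le_div_iff₀ hP']
      push_cast at hPn
      calc (m : ℝ) * P ≤ m * (p * (g * n)) := by gcongr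
        _ = _ := by ring
    have h2 : (n : ℝ) ≤ p * X := by
      rw [hX, ← mul_div_assoc, le_div_iff₀ hP']
      push_cast at hPm
      calc (n : ℝ) * P ≤ n * (p * (g * m)) := by gcongr
        _ = _ := by ring
    push_cast
    nlinarith
  set T := filter (fun x : ℕ × ℕ => x.1.Coprime (g * m) ∧ x.2.Coprime (g * n) ∧
    x.2 * (g * m) < x.1 * (g * n) ∧ x.2 * (g * m) ≡ x.1 * (g * n) [MOD P])
    (range (g * m) ×ˢ range (g * n)) with hT
  have hmaps : ∀ x ∈ T, (x.1 * n - x.2 * m) / P * P = x.1 * n - x.2 * m ∧ x.2 * m < x.1 * n := by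
    intro x hx
    obtain ⟨-, -, -, h1, h2⟩ := mem_filter.1 hx
    have h3 : x.2 * m < x.1 * n := by
      refine lt_of_mul_lt_mul_left (a := g) ?_ (Nat.zero_le _)
      linarith
    refine ⟨Nat.div_mul_cancel ?_, h3⟩
    have h4 : g * (x.2 * m) ≡ g * (x.1 * n) [MOD P] := by
      convert h2 using 1 <;> ring
    exact (Nat.modEq_iff_dvd' h3.le).1 (h4.cancel_left_of_coprime hPg)
  have hmem : ∀ x ∈ T, (x.1 * n - x.2 * m) / P ∈ {c ∈ Icc 1 ⌊X⌋₊ | c.Coprime (m * n)} := by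
    intro x hx
    obtain ⟨h1, h2⟩ := hmaps x hx
    obtain ⟨hr, hc1, hc2, -, -⟩ := mem_filter.1 hx
    set c := (x.1 * n - x.2 * m) / P
    have hcP : x.1 * n = x.2 * m + c * P := by omega
    have hc0 : 0 < c := by
      rcases Nat.eq_zero_or_pos c with h | h
      · rw [h] at hcP; omega
      · exact h
    refine mem_filter.2 ⟨mem_Icc.2 ⟨hc0, Nat.le_floor ?_⟩, ?_⟩
    · rw [hX, le_div_iff₀ hP']
      have : c * P ≤ g * (m * n) := by
        have := (mem_range.1 (mem_product.1 hr).1).le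
        calc c * P ≤ x.1 * n := by omega
          _ ≤ g * m * n := by gcongr
          _ = _ := by ring
      exact_mod_cast this
    · refine Nat.Coprime.mul_right ?_ ?_
      · refine Nat.coprime_of_dvd fun q hq hqc hqm => ?_
        have h3 : q ∣ x.1 * n := hcP ▸ dvd_add (hqm.mul_left _) (hqc.mul_right _)
        rcases hq.dvd_mul.1 h3 with h | h
        · exact Nat.not_coprime_of_dvd_of_dvd hq.one_lt h (hqm.mul_left g) hc1
        · exact Nat.not_coprime_of_dvd_of_dvd hq.one_lt hqm h hmn
      · refine Nat.coprime_of_dvd fun q hq hqc hqn => ?_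
        have h3 : q ∣ x.2 * m := by
          refine (Nat.dvd_add_iff_left (hqc.mul_right P)).2 ?_
          rw [← hcP]
          exact hqn.mul_left _
        rcases hq.dvd_mul.1 h3 with h | h
        · exact Nat.not_coprime_of_dvd_of_dvd hq.one_lt h (hqn.mul_left g) hc2
        · exact Nat.not_coprime_of_dvd_of_dvd hq.one_lt h hqn hmn
  have hfib : ∀ c ∈ {c ∈ Icc 1 ⌊X⌋₊ | c.Coprime (m * n)},
      (#{x ∈ T | (x.1 * n - x.2 * m) / P = c} : ℝ) ≤
        g * totientRatio g * (κ * (totientRatio c)⁻¹) := by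
    intro c hc
    have hc0 : c ≠ 0 := by have := (mem_Icc.1 (mem_filter.1 hc).1).1; omega
    calc (#{x ∈ T | (x.1 * n - x.2 * m) / P = c} : ℝ)
        ≤ #{x ∈ range (g * m) ×ˢ range (g * n) | x.1.Coprime (g * m) ∧ x.2.Coprime (g * n) ∧
            x.1 * n = x.2 * m + c * P} := by
          norm_cast
          refine card_le_card fun x hx => ?_
          obtain ⟨hxT, hxc⟩ := mem_filter.1 hx
          obtain ⟨h1, h2⟩ := hmaps x hxT
          obtain ⟨h3, h4, h5, -⟩ := mem_filter.1 hxT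
          rw [hxc] at h1
          exact mem_filter.2 ⟨h3, h4, h5, by omega⟩
      _ ≤ _ := card_reduced_pairs_eq_le hg hm hmn hPg
      _ ≤ _ := mul_le_mul_of_nonneg_left (prod_not_dvd_le g (m * n) hc0)
          (mul_nonneg (by positivity) (totientRatio_pos g).le)
  have hρg := totientRatio_pos g
  rw [card_eq_sum_card_fiberwise hmem, totient_mul_totient_eq hg hm hn hmn]
  push_cast
  calc _ ≤ ∑ c ∈ Icc 1 ⌊X⌋₊ with c.Coprime (m * n),
        g * totientRatio g * (κ * (totientRatio c)⁻¹) := sum_le_sum hfib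
    _ = g * totientRatio g * (κ * ∑ c ∈ Icc 1 ⌊X⌋₊ with c.Coprime (m * n), (totientRatio c)⁻¹) := by
        rw [mul_sum, mul_sum]
    _ ≤ g * totientRatio g * (κ * (C * (X * totientRatio (m * n)))) := by
        gcongr
        exact hsum (m * n) X (by positivity) (by positivity) hNX
    _ = g * totientRatio g * (C * X * (κ * totientRatio (m * n))) := by ring
    _ = _ := by
        rw [prod_not_dvd_mul_totientRatio hg (by positivity : 0 < m * n), hX]
        ring

/-- Pairs of reduced fractions with denominators `m`, `n` and congruent modulo `P`. -/
theorem exists_card_reduced_pairs_le (p : ℝ) (hp : 0 < p) :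
    ∃ C : ℝ, 0 < C ∧ ∀ m n P : ℕ, 0 < m → 0 < n → 0 < P → P.Coprime m → P.Coprime n →
      (P : ℝ) ≤ p * m → (P : ℝ) ≤ p * n →
      (#{x ∈ range m ×ˢ range n | x.1.Coprime m ∧ x.2.Coprime n ∧
        x.2 * m ≡ x.1 * n [MOD P]} : ℝ) ≤
        C * (m.totient * n.totient / P) + if m = n then (n.totient : ℝ) else 0 := by
  classical
  obtain ⟨C, hC, h⟩ := exists_card_reduced_pairs_lt_le p hp
  refine ⟨2 * C, by positivity, fun m n P hm hn hP hPm hPn hPm' hPn' => ?_⟩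
  have h1 := h m n P hm hn hP hPm hPm' hPn'
  have h2 := h n m P hn hm hP hPn hPn' hPm'
  set A := filter (fun x : ℕ × ℕ => x.1.Coprime m ∧ x.2.Coprime n ∧ x.2 * m < x.1 * n ∧
        x.2 * m ≡ x.1 * n [MOD P]) (range m ×ˢ range n)
  set B := filter (fun x : ℕ × ℕ => x.1.Coprime n ∧ x.2.Coprime m ∧ x.2 * n < x.1 * m ∧
        x.2 * n ≡ x.1 * m [MOD P]) (range n ×ˢ range m)
  set D := if m = n then (filter (fun a : ℕ => n.Coprime a) (range n)).image (fun a => (a, a)) else ∅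
    with hD
  have hsub : filter (fun x : ℕ × ℕ => x.1.Coprime m ∧ x.2.Coprime n ∧
        x.2 * m ≡ x.1 * n [MOD P]) (range m ×ˢ range n) ⊆ A ∪ B.image Prod.swap ∪ D := by
    rintro ⟨a, b⟩ hx
    obtain ⟨h3, h4, h5, h6⟩ := mem_filter.1 hx
    simp only at h4 h5 h6
    obtain ⟨h7, h8⟩ := mem_product.1 h3
    rw [mem_union, mem_union]
    rcases lt_trichotomy (b * m) (a * n) with hlt | heq | hlt
    · exact Or.inl (Or.inl (mem_filter.2 ⟨h3, h4, h5, hlt, h6⟩))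
    · right
      have hmn : m = n := by
        apply Nat.dvd_antisymm
        · exact h4.symm.dvd_of_dvd_mul_left (heq ▸ dvd_mul_left _ _)
        · exact h5.symm.dvd_of_dvd_mul_left (heq ▸ dvd_mul_left _ _)
      subst hmn
      have hab : b = a := Nat.eq_of_mul_eq_mul_right hm heq
      subst hab
      rw [hD, if_pos rfl]
      exact mem_image.2 ⟨b, mem_filter.2 ⟨h8, h5.symm⟩, rfl⟩
    · exact Or.inl (Or.inr (mem_image.2 ⟨(b, a), mem_filter.2
        ⟨mem_product.2 ⟨h8, h7⟩, h5, h4, hlt, h6.symm⟩, rfl⟩))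
  have hDc : (#D : ℝ) ≤ if m = n then (n.totient : ℝ) else 0 := by
    rw [hD]
    split_ifs
    · exact_mod_cast card_image_le
    · simp
  have hc : (#(A ∪ B.image Prod.swap ∪ D) : ℝ) ≤ #A + #B + #D := by
    norm_cast
    refine (card_union_le _ _).trans (Nat.add_le_add_right ((card_union_le _ _).trans ?_) _)
    exact Nat.add_le_add_left card_image_le _
  have hc' := (Nat.cast_le (α := ℝ)).2 (card_le_card hsub)
  rw [mul_comm (n.totient : ℝ)] at h2
  linarith

theorem eventually_card_coprime_modEq_ge (P : ℕ) (hP : 0 < P) :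
    ∃ n₀ : ℕ, ∀ n ≥ n₀, ∀ Q ≤ P, 0 < Q → Q.Coprime n → ∀ s : ℕ,
      (n.totient : ℝ) / (2 * Q) ≤ #{b ∈ range n | b ≡ s [MOD Q] ∧ b.Coprime n} := by
  obtain ⟨K, hK, hKn⟩ := four_pow_card_primeFactors_pow_le
  obtain ⟨n₀, hn₀⟩ := exists_nat_gt (16 * P ^ 4 * K + 1)
  refine ⟨n₀, fun n hn Q hQP hQ hQn s => ?_⟩
  have hnr : 16 * P ^ 4 * K + 1 < n := hn₀.trans_le (by exact_mod_cast hn)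
  have hn1 : (1 : ℝ) < n := by
    have : 0 < 16 * (P : ℝ) ^ 4 * K := by positivity
    linarith
  have hn0 : 0 < n := by
    have : (0 : ℝ) < n := by linarith
    exact_mod_cast this
  have h := (abs_le.1 (card_coprime_modEq_sub_le n n Q hn0 hQ hQn s)).1
  have hQ' : (0 : ℝ) < Q := by exact_mod_cast hQ
  have hQP' : (Q : ℝ) ≤ P := by exact_mod_cast hQP
  have h2 : (2 : ℝ) ^ #n.primeFactors ≤ 4 ^ #n.primeFactors * totientRatio n := by
    have := one_le_two_pow_mul_totientRatio n
    have e : (4 : ℝ) ^ #n.primeFactors = 2 ^ #n.primeFactors * 2 ^ #n.primeFactors := by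
      rw [← mul_pow]; norm_num
    rw [e, mul_assoc]
    exact le_mul_of_one_le_right (by positivity) this
  have h3 : 2 * P * (4 : ℝ) ^ #n.primeFactors ≤ n := by
    refine le_of_pow_le_pow_left₀ (n := 4) (by norm_num) (by positivity) ?_
    calc (2 * P * (4 : ℝ) ^ #n.primeFactors) ^ 4
        = 16 * P ^ 4 * ((4 : ℝ) ^ #n.primeFactors) ^ 4 := by ring
      _ ≤ 16 * P ^ 4 * (K * n) := by gcongr; exact hKn n hn0
      _ = (16 * P ^ 4 * K) * n := by ring
      _ ≤ n * n := by gcongr; linarith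
      _ = n ^ 2 := by ring
      _ ≤ n ^ 4 := pow_le_pow_right₀ hn1.le (by norm_num)
  have hρ := totientRatio_pos n
  have h4 : (2 : ℝ) ^ #n.primeFactors ≤ n * totientRatio n / (2 * Q) := by
    rw [le_div_iff₀ (by positivity)]
    calc (2 : ℝ) ^ #n.primeFactors * (2 * Q)
        ≤ (4 ^ #n.primeFactors * totientRatio n) * (2 * P) := by gcongr
      _ = (2 * P * 4 ^ #n.primeFactors) * totientRatio n := by ring
      _ ≤ _ := by gcongr
  rw [totient_eq_mul_totientRatio]
  have e : (n : ℝ) / Q * totientRatio n = n * totientRatio n / (2 * Q) + n * totientRatio n / (2 * Q) := by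
    field_simp; ring
  linarith

end NumberTheory

theorem sq_sum_measureReal_inter_le {Ω ι : Type*} [MeasurableSpace Ω] (μ : Measure Ω)
    [IsProbabilityMeasure μ] (I : Finset ι) (U : ι → Set Ω) (hU : ∀ i, MeasurableSet (U i))
    {D : Set Ω} (hD : MeasurableSet D) :
    (∑ i ∈ I, μ.real (U i ∩ D)) ^ 2 ≤
      μ.real D * ∑ i ∈ I, ∑ j ∈ I, μ.real (U i ∩ U j) := by
  have hind : ∀ s : Set Ω, MeasurableSet s → Integrable (s.indicator (1 : Ω → ℝ)) μ := fun s hs =>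
    (integrable_const 1).indicator hs
  have hkey : ∀ t : ℝ, 0 ≤ μ.real D * (t * t) + (-2 * ∑ i ∈ I, μ.real (U i ∩ D)) * t +
      ∑ i ∈ I, ∑ j ∈ I, μ.real (U i ∩ U j) := by
    intro t
    have e : ∀ x, (t * D.indicator (1 : Ω → ℝ) x - ∑ i ∈ I, (U i).indicator (1 : Ω → ℝ) x) ^ 2 =
        (t * t) * D.indicator (1 : Ω → ℝ) x
          - 2 * t * ∑ i ∈ I, (U i ∩ D).indicator (1 : Ω → ℝ) x
          + ∑ i ∈ I, ∑ j ∈ I, (U i ∩ U j).indicator (1 : Ω → ℝ) x := by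
      intro x
      have h1 : ∀ s s' : Set Ω, (s ∩ s').indicator (1 : Ω → ℝ) x =
          s.indicator 1 x * s'.indicator 1 x := by
        intro s s'; rw [Set.inter_indicator_one]; rfl
      have h2 : D.indicator (1 : Ω → ℝ) x * D.indicator 1 x = D.indicator 1 x := by
        rw [← h1, Set.inter_self]
      simp only [h1, ← Finset.sum_mul, ← Finset.mul_sum]
      linear_combination (t * t) * h2
    have h0 : 0 ≤ ∫ x, (t * D.indicator (1 : Ω → ℝ) x
        - ∑ i ∈ I, (U i).indicator (1 : Ω → ℝ) x) ^ 2 ∂μ := integral_nonneg fun x => sq_nonneg _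
    have hi1 : Integrable (fun x => ∑ i ∈ I, (U i ∩ D).indicator (1 : Ω → ℝ) x) μ :=
      integrable_finsetSum _ fun i _ => hind _ ((hU i).inter hD)
    have hi2 : ∀ i, Integrable (fun x => ∑ j ∈ I, (U i ∩ U j).indicator (1 : Ω → ℝ) x) μ :=
      fun i => integrable_finsetSum _ fun j _ => hind _ ((hU i).inter (hU j))
    have hi3 : Integrable (fun x => (t * t) * D.indicator (1 : Ω → ℝ) x
        - 2 * t * ∑ i ∈ I, (U i ∩ D).indicator (1 : Ω → ℝ) x) μ :=
      ((hind D hD).const_mul _).sub (hi1.const_mul _)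
    simp only [e] at h0
    rw [integral_add hi3
        (integrable_finsetSum _ fun i _ => hi2 i),
      integral_sub ((hind D hD).const_mul _) (hi1.const_mul _), integral_const_mul,
      integral_const_mul, integral_finsetSum _ fun i _ => hind _ ((hU i).inter hD),
      integral_finsetSum _ fun i _ => hi2 i, integral_indicator_one hD] at h0
    have e1 : ∀ i ∈ I, ∫ x, (U i ∩ D).indicator (1 : Ω → ℝ) x ∂μ = μ.real (U i ∩ D) :=
      fun i _ => integral_indicator_one ((hU i).inter hD)
    have e2 : ∀ i ∈ I, ∫ x, ∑ j ∈ I, (U i ∩ U j).indicator (1 : Ω → ℝ) x ∂μ =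
        ∑ j ∈ I, μ.real (U i ∩ U j) := by
      intro i _
      rw [integral_finsetSum _ fun j _ => hind _ ((hU i).inter (hU j))]
      exact Finset.sum_congr rfl fun j _ => integral_indicator_one ((hU i).inter (hU j))
    rw [Finset.sum_congr rfl e1, Finset.sum_congr rfl e2] at h0
    linarith
  have := discrim_le_zero hkey
  rw [discrim] at this
  nlinarith

/-- A set of positive measure cannot eventually avoid a family of sets that is quasi-independent on
average, has divergent total measure, and charges good approximations of the set proportionally. -/
theorem measureReal_eq_zero_of_quasi_independent {Ω : Type*} [MeasurableSpace Ω] (μ : Measure Ω)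
    [IsProbabilityMeasure μ] (J : ℕ → Finset ℕ) (U : ℕ → ℕ → Set Ω)
    (hU : ∀ n b, MeasurableSet (U n b)) (w : ℕ → ℝ) (hw : ∀ n, 0 ≤ w n) (hdiv : ¬ Summable w)
    {C : ℝ} (hC : 0 ≤ C)
    (hover : ∀ m n, ∑ a ∈ J m, ∑ b ∈ J n, μ.real (U m a ∩ U n b) ≤
      C * (w m * w n) + if m = n then w n else 0)
    {A : Set Ω} (hA : MeasurableSet A) {M : ℕ} (hAU : ∀ n ≥ M, ∀ b ∈ J n, Disjoint (U n b) A)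
    {c : ℝ} (hc : 0 < c)
    (happ : ∀ ε > 0, ∃ A', A ⊆ A' ∧ MeasurableSet A' ∧ μ.real (A' \ A) < ε ∧
      ∃ n₀ : ℕ, ∀ n ≥ n₀, c * w n * μ.real A' ≤ ∑ b ∈ J n, μ.real (U n b ∩ A')) :
    μ.real A = 0 := by
  by_contra hne
  have hα : 0 < μ.real A := lt_of_le_of_ne measureReal_nonneg (Ne.symm hne)
  set α := μ.real A
  have hε : 0 < (c * α) ^ 2 / (2 * (C + 1)) := by positivity
  obtain ⟨A', hAA', hA', hlt, n₀, hn₀⟩ := happ _ hε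
  set n₁ := max M n₀
  obtain ⟨N, hN, hNn⟩ : ∃ N, 1 ≤ ∑ n ∈ Finset.Ico n₁ N, w n ∧ n₁ ≤ N := by
    have h := (not_summable_iff_tendsto_nat_atTop_of_nonneg hw).1 hdiv
    obtain ⟨N, h1, h2⟩ := ((h.eventually_ge_atTop (1 + ∑ n ∈ Finset.range n₁, w n)).and
      (eventually_ge_atTop n₁)).exists
    refine ⟨N, ?_, h2⟩
    rw [Finset.sum_Ico_eq_sub _ h2]
    linarith
  set W := ∑ n ∈ Finset.Ico n₁ N, w n with hW
  have hcs := sq_sum_measureReal_inter_le μ ((Finset.Ico n₁ N).sigma J) (fun i => U i.1 i.2)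
    (fun i => hU _ _) (hA'.diff hA)
  simp only [Finset.sum_sigma] at hcs
  have hlow : c * W * α ≤ ∑ n ∈ Finset.Ico n₁ N, ∑ b ∈ J n, μ.real (U n b ∩ (A' \ A)) := by
    rw [hW, Finset.mul_sum, Finset.sum_mul]
    refine Finset.sum_le_sum fun n hn => ?_
    have hn1 := (Finset.mem_Ico.1 hn).1
    have e : ∀ b ∈ J n, μ.real (U n b ∩ (A' \ A)) = μ.real (U n b ∩ A') := by
      intro b hb
      congr 1
      ext x
      have : x ∈ U n b → x ∉ A := fun h =>
        Set.disjoint_left.1 (hAU n ((le_max_left _ _).trans hn1) b hb) h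
      simp only [Set.mem_inter_iff, Set.mem_sdiff]
      tauto
    rw [Finset.sum_congr rfl e]
    refine le_trans ?_ (hn₀ n ((le_max_right _ _).trans hn1))
    have := hw n
    gcongr
    exact measureReal_mono hAA'
  have hup : ∑ m ∈ Finset.Ico n₁ N, ∑ a ∈ J m, ∑ n ∈ Finset.Ico n₁ N, ∑ b ∈ J n,
      μ.real (U m a ∩ U n b) ≤ (C + 1) * W ^ 2 := by
    calc _ = ∑ m ∈ Finset.Ico n₁ N, ∑ n ∈ Finset.Ico n₁ N, ∑ a ∈ J m, ∑ b ∈ J n,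
          μ.real (U m a ∩ U n b) := Finset.sum_congr rfl fun m _ => Finset.sum_comm
      _ ≤ ∑ m ∈ Finset.Ico n₁ N, ∑ n ∈ Finset.Ico n₁ N,
          (C * (w m * w n) + if m = n then w n else 0) :=
        Finset.sum_le_sum fun m _ => Finset.sum_le_sum fun n _ => hover m n
      _ = C * W ^ 2 + W := by
        simp only [Finset.sum_add_distrib, ← Finset.mul_sum, ← Finset.sum_mul]
        rw [sq, ← hW]
        congr 1
        refine Finset.sum_congr rfl fun m hm => ?_
        rw [Finset.sum_ite_eq, if_pos hm]
      _ ≤ _ := by nlinarith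
  have h1 : (c * W * α) ^ 2 ≤ ((c * α) ^ 2 / (2 * (C + 1))) * ((C + 1) * W ^ 2) := by
    calc (c * W * α) ^ 2 ≤ _ := pow_le_pow_left₀ (by positivity) hlow 2
      _ ≤ _ := hcs
      _ ≤ _ := mul_le_mul hlt.le hup (Finset.sum_nonneg fun _ _ => Finset.sum_nonneg fun _ _ =>
          Finset.sum_nonneg fun _ _ => Finset.sum_nonneg fun _ _ => measureReal_nonneg) hε.le
  have h2 : ((c * α) ^ 2 / (2 * (C + 1))) * ((C + 1) * W ^ 2) = (c * W * α) ^ 2 / 2 := by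
    have : C + 1 ≠ 0 := by positivity
    field_simp
  have h3 : 0 < (c * W * α) ^ 2 := by positivity
  linarith

namespace PadicInt

variable {p : ℕ} [Fact p.Prime]

theorem norm_le_inv_pow_iff (x : ℤ_[p]) (k : ℕ) :
    ‖x‖ ≤ ((p : ℝ) ^ k)⁻¹ ↔ toZModPow k x = 0 := by
  rw [← RingHom.mem_ker, ker_toZModPow, ← norm_le_pow_iff_mem_span_pow, zpow_neg, zpow_natCast]

theorem isOpen_preimage_toZModPow (k : ℕ) (s : Set (ZMod (p ^ k))) :
    IsOpen ((toZModPow k : ℤ_[p] → ZMod (p ^ k)) ⁻¹' s) := by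
  have hp : 0 < (p : ℝ) := by exact_mod_cast (Fact.out : p.Prime).pos
  refine Metric.isOpen_iff.2 fun x hx => ⟨((p : ℝ) ^ k)⁻¹, by positivity, fun y hy => ?_⟩
  have h := (norm_le_inv_pow_iff (y - x) k).1 (by rw [← dist_eq_norm]; exact (Metric.mem_ball.1 hy).le)
  rw [map_sub, sub_eq_zero] at h
  rw [Set.mem_preimage, h]
  exact hx

theorem toZModPow_eq_of_le {i j : ℕ} (h : i ≤ j) {x y : ℤ_[p]}
    (hxy : toZModPow j x = toZModPow j y) : toZModPow i x = toZModPow i y := by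
  rw [← cast_toZModPow i j h x, ← cast_toZModPow i j h y, hxy]

/-- The set of `x` with `n x ≡ b` modulo `p ^ k`. -/
def residueSet (p : ℕ) [Fact p.Prime] (k n b : ℕ) : Set ℤ_[p] :=
  {x | toZModPow k x * (n : ZMod (p ^ k)) = (b : ZMod (p ^ k))}

theorem residueSet_eq_preimage {k n : ℕ} (hn : p.Coprime n) (b : ℕ) :
    residueSet p k n b =
      (toZModPow k : ℤ_[p] → ZMod (p ^ k)) ⁻¹' {(b : ZMod (p ^ k)) * (n : ZMod (p ^ k))⁻¹} := by
  have h := ZMod.coe_mul_inv_eq_one n ((Nat.Coprime.pow_left k hn).symm)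
  ext x
  simp only [residueSet, Set.mem_ofPred_eq, Set.mem_preimage, Set.mem_singleton_iff]
  constructor
  · intro e
    rw [← e, mul_assoc, h, mul_one]
  · intro e
    rw [e, mul_assoc, mul_comm _⁻¹, h, mul_one]

theorem isOpen_residueSet (k n b : ℕ) : IsOpen (residueSet p k n b) :=
  isOpen_preimage_toZModPow k {z | z * (n : ZMod (p ^ k)) = (b : ZMod (p ^ k))}

theorem norm_sub_div_eq {n : ℕ} (hn : p.Coprime n) (x : ℤ_[p]) (a : ℤ) :
    ‖(x : ℚ_[p]) - (a : ℚ_[p]) / (n : ℚ_[p])‖ = ‖x * (n : ℤ_[p]) - (a : ℤ_[p])‖ := by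
  have h1 : ‖(n : ℚ_[p])‖ = 1 := Padic.norm_natCast_eq_one_iff.2 hn
  have h0 : (n : ℚ_[p]) ≠ 0 := norm_ne_zero_iff.1 (by rw [h1]; exact one_ne_zero)
  have : (x : ℚ_[p]) - (a : ℚ_[p]) / (n : ℚ_[p]) =
      ((x * (n : ℤ_[p]) - (a : ℤ_[p]) : ℤ_[p]) : ℚ_[p]) / (n : ℚ_[p]) := by
    push_cast
    field_simp
  rw [this, norm_div, h1, div_one, padic_norm_e_of_padicInt]

theorem norm_sub_div_le_iff {n : ℕ} (hn : p.Coprime n) (x : ℤ_[p]) (a : ℤ) (k : ℕ) :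
    ‖(x : ℚ_[p]) - (a : ℚ_[p]) / (n : ℚ_[p])‖ ≤ ((p : ℝ) ^ k)⁻¹ ↔
      toZModPow k x * (n : ZMod (p ^ k)) = (a : ZMod (p ^ k)) := by
  rw [norm_sub_div_eq hn, norm_le_inv_pow_iff, map_sub, map_mul, map_natCast, map_intCast,
    sub_eq_zero]

theorem norm_le_inv_pow_of_forall_lt {x : ℤ_[p]} {r : ℝ} (hx : ‖x‖ ≤ r) {k : ℕ}
    (hk : ∀ j < k, r < ((p : ℝ) ^ j)⁻¹) : ‖x‖ ≤ ((p : ℝ) ^ k)⁻¹ := by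
  cases k with
  | zero => simpa using norm_le_one x
  | succ j =>
    have h := hx.trans_lt (hk j j.lt_succ_self)
    rw [← zpow_natCast, ← zpow_neg, norm_lt_pow_iff_norm_le_pow_sub_one] at h
    rw [← zpow_natCast, ← zpow_neg]
    convert h using 2
    push_cast
    ring

variable [MeasurableSpace ℤ_[p]] [BorelSpace ℤ_[p]]

theorem measurableSet_preimage_toZModPow (k : ℕ) (s : Set (ZMod (p ^ k))) :
    MeasurableSet ((toZModPow k : ℤ_[p] → ZMod (p ^ k)) ⁻¹' s) :=
  (isOpen_preimage_toZModPow k s).measurableSet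

theorem measureReal_preimage_toZModPow_singleton (μ : Measure ℤ_[p]) [μ.IsAddHaarMeasure]
    [IsProbabilityMeasure μ] (k : ℕ) (z : ZMod (p ^ k)) :
    μ.real ((toZModPow k : ℤ_[p] → ZMod (p ^ k)) ⁻¹' {z}) = ((p : ℝ) ^ k)⁻¹ := by
  have hp : (p : ℝ) ≠ 0 := by exact_mod_cast (Fact.out : p.Prime).ne_zero
  have : NeZero (p ^ k) := ⟨pow_ne_zero _ (Fact.out : p.Prime).ne_zero⟩
  have htrans : ∀ w : ZMod (p ^ k), μ.real ((toZModPow k : ℤ_[p] → ZMod (p ^ k)) ⁻¹' {w}) =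
      μ.real ((toZModPow k : ℤ_[p] → ZMod (p ^ k)) ⁻¹' {z}) := by
    intro w
    obtain ⟨t, ht⟩ := ZMod.ringHom_surjective (toZModPow k : ℤ_[p] →+* ZMod (p ^ k)) (w - z)
    rw [measureReal_def, measureReal_def,
      ← measure_preimage_add μ t ((toZModPow k : ℤ_[p] → ZMod (p ^ k)) ⁻¹' {w})]
    congr 2
    ext x
    simp only [Set.mem_preimage, Set.mem_singleton_iff, map_add, ht]
    constructor
    · intro h; linear_combination h
    · intro h; linear_combination h
  have hun : ∑ w : ZMod (p ^ k), μ.real ((toZModPow k : ℤ_[p] → ZMod (p ^ k)) ⁻¹' {w}) = 1 := by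
    rw [← probReal_univ (μ := μ), ← measureReal_biUnion_finset]
    · congr 1
      ext x
      simp
    · intro a _ b _ hab
      exact (Set.disjoint_singleton.2 hab).preimage _
    · exact fun w _ => measurableSet_preimage_toZModPow k _
  simp only [htrans, Finset.sum_const, Finset.card_univ, ZMod.card, nsmul_eq_mul] at hun
  push_cast at hun
  exact eq_inv_of_mul_eq_one_right hun

theorem measureReal_residueSet (μ : Measure ℤ_[p]) [μ.IsAddHaarMeasure]
    [IsProbabilityMeasure μ] {k n : ℕ} (hn : p.Coprime n) (b : ℕ) :
    μ.real (residueSet p k n b) = ((p : ℝ) ^ k)⁻¹ := by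
  rw [residueSet_eq_preimage hn, measureReal_preimage_toZModPow_singleton]

end PadicInt

theorem exists_pow_scale {p : ℕ} (hp : 1 < p) {n : ℕ} (hn : 0 < n) {r : ℝ} (hr : 1 / (n : ℝ) ≤ r) :
    ∃ k : ℕ, ((p : ℝ) ^ k)⁻¹ ≤ r ∧ (p : ℝ) ^ k ≤ p * n ∧ ∀ j < k, r < ((p : ℝ) ^ j)⁻¹ := by
  have hp' : (1 : ℝ) < p := by exact_mod_cast hp
  have hn' : (0 : ℝ) < n := by exact_mod_cast hn
  have hn1 : (1 : ℝ) ≤ n := by exact_mod_cast hn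
  have hex : ∃ k : ℕ, ((p : ℝ) ^ k)⁻¹ ≤ r := by
    obtain ⟨k, hk⟩ := pow_unbounded_of_one_lt (n : ℝ) hp'
    refine ⟨k, le_trans ?_ hr⟩
    rw [one_div]
    exact inv_anti₀ hn' hk.le
  classical
  have hmin : ∀ j < Nat.find hex, r < ((p : ℝ) ^ j)⁻¹ := fun j hj => not_le.1 (Nat.find_min hex hj)
  refine ⟨Nat.find hex, Nat.find_spec hex, ?_, hmin⟩
  rcases h : Nat.find hex with _ | j
  · rw [pow_zero]
    nlinarith
  · have h1 := hr.trans_lt (hmin j (by omega))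
    rw [one_div] at h1
    have h2 := (inv_lt_inv₀ hn' (by positivity)).1 h1
    rw [pow_succ, mul_comm]
    gcongr

theorem card_int_coprime_le {n : ℕ} (hn : 0 < n) :
    ((Finset.Icc (-(n : ℤ)) n).filter fun a => Int.gcd a n = 1).card ≤ 3 * n.totient := by
  classical
  set B := (Finset.range n).filter fun b => n.Coprime b with hB
  have hsub : ((Finset.Icc (-(n : ℤ)) n).filter fun a => Int.gcd a n = 1) ⊆
      B.image (fun b : ℕ => (b : ℤ)) ∪ B.image (fun b : ℕ => (b : ℤ) - n) ∪
        B.image (fun b : ℕ => (b : ℤ) + n) := by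
    intro a ha
    rw [Finset.mem_filter, Finset.mem_Icc] at ha
    obtain ⟨⟨h1, h2⟩, h3⟩ := ha
    have key : ∀ t : ℤ, 0 ≤ a + t * n → a + t * n < n → (a + t * n).toNat ∈ B := by
      intro t h4 h5
      rw [hB, Finset.mem_filter, Finset.mem_range]
      refine ⟨by omega, ?_⟩
      rw [Nat.coprime_comm, Nat.Coprime, ← Int.gcd_natCast_natCast, Int.toNat_of_nonneg h4]
      simpa using h3
    simp only [Finset.mem_union, Finset.mem_image]
    rcases lt_trichotomy a 0 with h | h | h
    · refine Or.inl (Or.inr ⟨_, key 1 (by omega) (by omega), by omega⟩)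
    · refine Or.inl (Or.inl ⟨_, key 0 (by omega) (by omega), by omega⟩)
    · rcases h2.lt_or_eq with h' | h'
      · refine Or.inl (Or.inl ⟨_, key 0 (by omega) (by omega), by omega⟩)
      · refine Or.inr ⟨_, key (-1) (by omega) (by omega), by omega⟩
  have hcard : B.card = n.totient := rfl
  calc _ ≤ _ := Finset.card_le_card hsub
    _ ≤ B.card + B.card + B.card := (Finset.card_union_le _ _).trans (add_le_add
        ((Finset.card_union_le _ _).trans (add_le_add Finset.card_image_le Finset.card_image_le))
        Finset.card_image_le)
    _ = 3 * n.totient := by rw [hcard]; ring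

section

variable {p : ℕ} [Fact p.Prime]

open PadicInt

theorem residueSet_subset_padicE {ψ : ℕ → ℝ} {n k b : ℕ} (hn : p.Coprime n)
    (hk : ((p : ℝ) ^ k)⁻¹ ≤ ψ n) (hb : b < n) (hbn : b.Coprime n) :
    residueSet p k n b ⊆ padicE p ψ n := by
  intro x hx
  refine ⟨b, ?_, by simpa [Int.gcd_natCast_natCast] using hbn, ?_⟩
  · rw [Nat.abs_cast]
    exact_mod_cast hb.le
  · refine le_trans ((norm_sub_div_le_iff hn x b k).2 ?_) hk
    rw [Int.cast_natCast]
    exact hx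

theorem padicE_eq_univ {ψ : ℕ → ℝ} {n : ℕ} (hn : p ∣ n) (hne : (padicE p ψ n).Nonempty) :
    padicE p ψ n = Set.univ := by
  obtain ⟨x, a, ha, hgcd, hx⟩ := hne
  refine Set.eq_univ_of_forall fun y => ⟨a, ha, hgcd, ?_⟩
  have hn0 : n ≠ 0 := by
    rintro rfl
    have : a = 0 := by simpa using ha
    simp [this] at hgcd
  have hnorm : ‖(a : ℚ_[p])‖ = 1 := by
    refine Padic.norm_intCast_eq_one_iff.2 ?_
    exact (Int.isCoprime_iff_gcd_eq_one.2 hgcd).of_isCoprime_of_dvd_right (by exact_mod_cast hn)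
  have hn1 : ‖(n : ℚ_[p])‖ < 1 := Padic.norm_natCast_lt_one_iff.2 hn
  have hnpos : 0 < ‖(n : ℚ_[p])‖ := norm_pos_iff.2 (by exact_mod_cast hn0)
  have hlarge : 1 < ‖(a : ℚ_[p]) / (n : ℚ_[p])‖ := by
    rw [norm_div, hnorm, one_lt_div hnpos]
    exact hn1
  have e : ∀ z : ℤ_[p], ‖(z : ℚ_[p]) - (a : ℚ_[p]) / (n : ℚ_[p])‖ =
      ‖(a : ℚ_[p]) / (n : ℚ_[p])‖ := by
    intro z
    have hz : ‖(z : ℚ_[p])‖ < ‖(a : ℚ_[p]) / (n : ℚ_[p])‖ := (norm_le_one z).trans_lt hlarge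
    rw [sub_eq_add_neg, Padic.add_eq_max_of_ne (by rw [norm_neg]; exact hz.ne), norm_neg,
      max_eq_right hz.le]
  rw [e y, ← e x]
  exact hx

variable [MeasurableSpace ℤ_[p]] [BorelSpace ℤ_[p]]

theorem measureReal_padicE_le (μ : Measure ℤ_[p]) [μ.IsAddHaarMeasure] [IsProbabilityMeasure μ]
    {ψ : ℕ → ℝ} {n k : ℕ} (hn0 : 0 < n) (hn : p.Coprime n)
    (hk : ∀ j < k, ψ n < ((p : ℝ) ^ j)⁻¹) :
    μ.real (padicE p ψ n) ≤ 3 * (n.totient / (p : ℝ) ^ k) := by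
  set T := (Finset.Icc (-(n : ℤ)) n).filter fun a => Int.gcd a n = 1 with hT
  have hinv := ZMod.coe_mul_inv_eq_one n ((Nat.Coprime.pow_left k hn).symm)
  have hsub : padicE p ψ n ⊆ ⋃ a ∈ T, (toZModPow k : ℤ_[p] → ZMod (p ^ k)) ⁻¹'
      {(a : ZMod (p ^ k)) * (n : ZMod (p ^ k))⁻¹} := by
    rintro x ⟨a, ha, hgcd, hx⟩
    refine Set.mem_biUnion (x := a) ?_ ?_
    · rw [hT, Finset.mem_coe, Finset.mem_filter, Finset.mem_Icc]
      exact ⟨abs_le.1 ha, hgcd⟩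
    · rw [norm_sub_div_eq hn] at hx
      have h := norm_le_inv_pow_of_forall_lt hx hk
      rw [← norm_sub_div_eq hn, norm_sub_div_le_iff hn] at h
      rw [Set.mem_preimage, Set.mem_singleton_iff, ← h, mul_assoc, hinv, mul_one]
  have hp : 0 < (p : ℝ) := by exact_mod_cast (Fact.out : p.Prime).pos
  calc μ.real (padicE p ψ n) ≤ _ := measureReal_mono hsub (measure_ne_top _ _)
    _ ≤ _ := measureReal_biUnion_finset_le T _
    _ = T.card * ((p : ℝ) ^ k)⁻¹ := by
      simp only [measureReal_preimage_toZModPow_singleton, Finset.sum_const, nsmul_eq_mul]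
    _ ≤ ((3 * n.totient : ℕ) : ℝ) * ((p : ℝ) ^ k)⁻¹ := by
      gcongr
      exact card_int_coprime_le hn0
    _ = _ := by
      push_cast
      ring

end

section

variable {p : ℕ} [Fact p.Prime]

open PadicInt

theorem residueSet_anti {i k : ℕ} (h : i ≤ k) (n b : ℕ) :
    residueSet p k n b ⊆ residueSet p i n b := by
  intro x hx
  have := toZModPow_eq_of_le h (x := x * (n : ℤ_[p])) (y := (b : ℤ_[p])) (by simpa [residueSet] using hx)
  simpa [residueSet] using this

theorem modEq_of_mem_residueSet {k m n a b : ℕ} {x : ℤ_[p]} (hm : x ∈ residueSet p k m a)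
    (hn : x ∈ residueSet p k n b) : b * m ≡ a * n [MOD p ^ k] := by
  rw [← ZMod.natCast_eq_natCast_iff]
  have h1 : toZModPow k x * (m : ZMod (p ^ k)) = (a : ZMod (p ^ k)) := hm
  have h2 : toZModPow k x * (n : ZMod (p ^ k)) = (b : ZMod (p ^ k)) := hn
  push_cast
  rw [← h1, ← h2]
  ring

variable [MeasurableSpace ℤ_[p]] [BorelSpace ℤ_[p]]

theorem exists_sum_measureReal_inter_residueSet_le (μ : Measure ℤ_[p]) [μ.IsAddHaarMeasure]
    [IsProbabilityMeasure μ] :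
    ∃ C : ℝ, 0 < C ∧ ∀ (k : ℕ → ℕ) (m n : ℕ), 0 < m → 0 < n → p.Coprime m → p.Coprime n →
      (p : ℝ) ^ k m ≤ p * m → (p : ℝ) ^ k n ≤ p * n →
      ∑ a ∈ (Finset.range m).filter (·.Coprime m), ∑ b ∈ (Finset.range n).filter (·.Coprime n),
        μ.real (residueSet p (k m) m a ∩ residueSet p (k n) n b) ≤
      C * (m.totient / (p : ℝ) ^ k m * (n.totient / (p : ℝ) ^ k n)) +
        if m = n then n.totient / (p : ℝ) ^ k n else 0 := by
  have hp : 0 < (p : ℝ) := by exact_mod_cast (Fact.out : p.Prime).pos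
  have hp1 : 1 ≤ (p : ℝ) := by exact_mod_cast (Fact.out : p.Prime).one_le
  obtain ⟨C, hC, h⟩ := exists_card_reduced_pairs_le (p : ℝ) hp
  refine ⟨C, hC, fun k m n hm hn hpm hpn hkm hkn => ?_⟩
  set l := min (k m) (k n) with hl
  set L := max (k m) (k n) with hL
  have hlm : (p : ℝ) ^ l ≤ (p : ℝ) ^ k m := pow_le_pow_right₀ hp1 (min_le_left _ _)
  have hln : (p : ℝ) ^ l ≤ (p : ℝ) ^ k n := pow_le_pow_right₀ hp1 (min_le_right _ _)
  have hcard := h m n (p ^ l) hm hn (pow_pos (Fact.out : p.Prime).pos _)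
    (Nat.Coprime.pow_left _ hpm) (Nat.Coprime.pow_left _ hpn)
    (by push_cast; exact hlm.trans hkm) (by push_cast; exact hln.trans hkn)
  have hterm : ∀ a b : ℕ, μ.real (residueSet p (k m) m a ∩ residueSet p (k n) n b) ≤
      if b * m ≡ a * n [MOD p ^ l] then ((p : ℝ) ^ L)⁻¹ else 0 := by
    intro a b
    split_ifs with hab
    · rcases le_total (k m) (k n) with hle | hle
      · rw [hL, max_eq_right hle, ← measureReal_residueSet μ hpn b]
        exact measureReal_mono Set.inter_subset_right
      · rw [hL, max_eq_left hle, ← measureReal_residueSet μ hpm a]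
        exact measureReal_mono Set.inter_subset_left
    · have : residueSet p (k m) m a ∩ residueSet p (k n) n b = ∅ := by
        refine Set.eq_empty_of_forall_notMem fun x hx => hab ?_
        exact modEq_of_mem_residueSet (residueSet_anti (min_le_left _ _) _ _ hx.1)
          (residueSet_anti (min_le_right _ _) _ _ hx.2)
      rw [this, measureReal_empty]
  have hprod : (p : ℝ) ^ l * (p : ℝ) ^ L = (p : ℝ) ^ k m * (p : ℝ) ^ k n := by
    rw [← pow_add, ← pow_add, hl, hL, min_add_max]
  calc _ ≤ ∑ a ∈ (Finset.range m).filter (·.Coprime m),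
        ∑ b ∈ (Finset.range n).filter (·.Coprime n),
          if b * m ≡ a * n [MOD p ^ l] then ((p : ℝ) ^ L)⁻¹ else 0 :=
      Finset.sum_le_sum fun a _ => Finset.sum_le_sum fun b _ => hterm a b
    _ = ((Finset.range m ×ˢ Finset.range n).filter fun x : ℕ × ℕ => x.1.Coprime m ∧
          x.2.Coprime n ∧ x.2 * m ≡ x.1 * n [MOD p ^ l]).card * ((p : ℝ) ^ L)⁻¹ := by
      rw [← nsmul_eq_mul, ← Finset.sum_const, ← Finset.sum_product', ← Finset.sum_filter]
      congr 1
      ext x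
      simp only [Finset.mem_filter, Finset.mem_product]
      tauto
    _ ≤ (C * (m.totient * n.totient / ((p ^ l : ℕ) : ℝ)) + if m = n then (n.totient : ℝ) else 0) *
          ((p : ℝ) ^ L)⁻¹ := by gcongr
    _ = _ := by
      rw [add_mul]
      congr 1
      · push_cast
        rw [← div_eq_mul_inv, mul_div_assoc, div_div, hprod, div_mul_div_comm]
      · split_ifs with hmn
        · subst hmn
          rw [hL, max_self, div_eq_mul_inv]
        · rw [zero_mul]

theorem eventually_le_sum_measureReal_residueSet_inter (μ : Measure ℤ_[p]) [μ.IsAddHaarMeasure]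
    [IsProbabilityMeasure μ] (j : ℕ) :
    ∃ n₀ : ℕ, ∀ n ≥ n₀, p.Coprime n → ∀ (k : ℕ) (z : ZMod (p ^ j)),
      2⁻¹ * (n.totient / (p : ℝ) ^ k) * ((p : ℝ) ^ j)⁻¹ ≤
        ∑ b ∈ (Finset.range n).filter (·.Coprime n), μ.real (residueSet p k n b ∩
          (toZModPow j : ℤ_[p] → ZMod (p ^ j)) ⁻¹' {z}) := by
  have hpp : p.Prime := Fact.out
  have hp : 0 < (p : ℝ) := by exact_mod_cast hpp.pos
  obtain ⟨n₀, h⟩ := eventually_card_coprime_modEq_ge (p ^ j) (pow_pos hpp.pos _)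
  refine ⟨n₀, fun n hn hpn k z => ?_⟩
  obtain ⟨y, rfl⟩ := ZMod.ringHom_surjective (toZModPow j : ℤ_[p] →+* ZMod (p ^ j)) z
  set i := min j k with hi
  set L := max j k with hL
  have : NeZero (p ^ i) := ⟨pow_ne_zero _ hpp.ne_zero⟩
  have hcard := h n hn (p ^ i) (Nat.pow_le_pow_right hpp.pos (min_le_left _ _))
    (pow_pos hpp.pos _) (Nat.Coprime.pow_left _ hpn)
    (toZModPow i y * (n : ZMod (p ^ i))).val
  have hterm : ∀ b : ℕ, b ≡ (toZModPow i y * (n : ZMod (p ^ i))).val [MOD p ^ i] →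
      ((p : ℝ) ^ L)⁻¹ ≤ μ.real (residueSet p k n b ∩
          (toZModPow j : ℤ_[p] → ZMod (p ^ j)) ⁻¹' {toZModPow j y}) := by
    intro b hb
    rw [← ZMod.natCast_eq_natCast_iff, ZMod.natCast_zmod_val] at hb
    rcases le_total j k with hle | hle
    · have hij : i = j := min_eq_left hle
      rw [hL, max_eq_right hle, ← measureReal_residueSet μ hpn b]
      refine measureReal_mono fun x hx => ⟨hx, ?_⟩
      have hx' : toZModPow j x * (n : ZMod (p ^ j)) = (b : ZMod (p ^ j)) := residueSet_anti hle _ _ hx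
      rw [hij] at hb
      have hu : IsUnit (n : ZMod (p ^ j)) :=
        (ZMod.isUnit_iff_coprime _ _).2 (Nat.Coprime.pow_left j hpn).symm
      exact hu.mul_right_cancel (hx'.trans hb)
    · have hik : i = k := min_eq_right hle
      rw [hL, max_eq_left hle, ← measureReal_preimage_toZModPow_singleton μ j (toZModPow j y)]
      refine measureReal_mono fun x hx => ⟨?_, hx⟩
      rw [hik] at hb
      have hxy : toZModPow k x = toZModPow k y := toZModPow_eq_of_le hle hx
      change toZModPow k x * (n : ZMod (p ^ k)) = (b : ZMod (p ^ k))
      rw [hxy, hb]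
  have hprod : (p : ℝ) ^ i * (p : ℝ) ^ L = (p : ℝ) ^ k * (p : ℝ) ^ j := by
    rw [← pow_add, ← pow_add, hi, hL, min_add_max, add_comm]
  calc 2⁻¹ * (n.totient / (p : ℝ) ^ k) * ((p : ℝ) ^ j)⁻¹
      = n.totient / (2 * ((p ^ i : ℕ) : ℝ)) * ((p : ℝ) ^ L)⁻¹ := by
        push_cast
        rw [← div_eq_mul_inv, ← div_eq_mul_inv, mul_div_assoc, div_div, div_div, mul_assoc 2,
          hprod, ← div_div _ 2]
        ring
    _ ≤ _ * ((p : ℝ) ^ L)⁻¹ := mul_le_mul_of_nonneg_right hcard (by positivity)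
    _ = ∑ b ∈ (Finset.range n).filter fun b => b ≡ (toZModPow i y * (n : ZMod (p ^ i))).val
          [MOD p ^ i] ∧ b.Coprime n, ((p : ℝ) ^ L)⁻¹ := by
      rw [Finset.sum_const, nsmul_eq_mul]
    _ ≤ ∑ b ∈ (Finset.range n).filter fun b => b ≡ (toZModPow i y * (n : ZMod (p ^ i))).val
          [MOD p ^ i] ∧ b.Coprime n, μ.real (residueSet p k n b ∩
          (toZModPow j : ℤ_[p] → ZMod (p ^ j)) ⁻¹' {toZModPow j y}) :=
      Finset.sum_le_sum fun b hb => hterm b (Finset.mem_filter.1 hb).2.1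
    _ ≤ _ := Finset.sum_le_sum_of_subset_of_nonneg
      (fun b hb => by
        rw [Finset.mem_filter] at hb ⊢
        exact ⟨hb.1, hb.2.2⟩) fun _ _ _ => measureReal_nonneg

theorem measureReal_inter_preimage_toZModPow (μ : Measure ℤ_[p]) [IsProbabilityMeasure μ]
    {U : Set ℤ_[p]} (hU : MeasurableSet U) (j : ℕ) (Z : Finset (ZMod (p ^ j))) :
    μ.real (U ∩ (toZModPow j : ℤ_[p] → ZMod (p ^ j)) ⁻¹' Z) =
      ∑ z ∈ Z, μ.real (U ∩ (toZModPow j : ℤ_[p] → ZMod (p ^ j)) ⁻¹' {z}) := by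
  rw [← measureReal_biUnion_finset]
  · congr 1
    ext x
    simp
  · intro a _ b _ hab
    exact ((Set.disjoint_singleton.2 hab).preimage _).mono Set.inter_subset_right
      Set.inter_subset_right
  · exact fun z _ => hU.inter (measurableSet_preimage_toZModPow j _)

theorem exists_measureReal_preimage_image_diff_lt (μ : Measure ℤ_[p]) [IsProbabilityMeasure μ]
    {A : Set ℤ_[p]} (hA : IsClosed A) {ε : ℝ} (hε : 0 < ε) :
    ∃ j, μ.real ((toZModPow j : ℤ_[p] → ZMod (p ^ j)) ⁻¹' (toZModPow j '' A) \ A) < ε := by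
  have hp1 : 1 < (p : ℝ) := by exact_mod_cast (Fact.out : p.Prime).one_lt
  have h1 : Tendsto (fun r => μ.real (Metric.cthickening r A)) (nhds 0) (nhds (μ.real A)) :=
    (ENNReal.tendsto_toReal (measure_ne_top μ A)).comp
      (tendsto_measure_cthickening_of_isClosed ⟨1, one_pos, measure_ne_top _ _⟩ hA)
  have h2 : Tendsto (fun j : ℕ => ((p : ℝ) ^ j)⁻¹) atTop (nhds 0) :=
    tendsto_inv_atTop_zero.comp (tendsto_pow_atTop_atTop_of_one_lt hp1)
  obtain ⟨j, hj⟩ := ((h1.comp h2).eventually (gt_mem_nhds (lt_add_of_pos_right _ hε))).exists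
  refine ⟨j, ?_⟩
  rw [measureReal_sdiff (Set.subset_preimage_image _ _) hA.measurableSet, sub_lt_iff_lt_add']
  refine (measureReal_mono ?_).trans_lt hj
  rintro x ⟨y, hy, hxy⟩
  refine Metric.mem_cthickening_of_dist_le x y _ A hy ?_
  rw [dist_eq_norm, norm_le_inv_pow_iff, map_sub, hxy, sub_self]

end

theorem tsum_measure_padicE_ne_top {p : ℕ} [Fact p.Prime] [MeasurableSpace ℤ_[p]]
    (μ : Measure ℤ_[p]) [IsProbabilityMeasure μ] {ψ : ℕ → ℝ} {w : ℕ → ℝ} (hw : Summable w)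
    (hfin : {n | p ∣ n ∧ (padicE p ψ n).Nonempty}.Finite)
    (hle : ∀ n, p.Coprime n → 1 / (n : ℝ) ≤ ψ n → μ.real (padicE p ψ n) ≤ w n) :
    ∑' n : {n : ℕ // 1 / (n : ℝ) ≤ ψ n}, μ (padicE p ψ n) ≠ ⊤ := by
  set F := {n | p ∣ n ∧ (padicE p ψ n).Nonempty} with hF
  have hterm : ∀ n : {n : ℕ // 1 / (n : ℝ) ≤ ψ n}, μ (padicE p ψ n) ≤
      (fun n : ℕ => ENNReal.ofReal (w n) + F.indicator 1 n) n := by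
    rintro ⟨n, hn⟩
    rcases (Nat.coprime_or_dvd_of_prime (Fact.out : p.Prime) n) with hpn | hpn
    · refine le_trans ?_ le_self_add
      rw [← ofReal_measureReal (measure_ne_top μ _)]
      exact ENNReal.ofReal_le_ofReal (hle n hpn hn)
    · refine le_trans ?_ le_add_self
      rcases (padicE p ψ n).eq_empty_or_nonempty with h | h
      · simp [h]
      · rw [Set.indicator_of_mem (show n ∈ F from ⟨hpn, h⟩)]
        exact prob_le_one
  have hF' : ∑' n, F.indicator (1 : ℕ → ENNReal) n ≠ ⊤ := by
    rw [tsum_eq_sum (s := hfin.toFinset) fun n hn =>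
      Set.indicator_of_notMem (by simpa using hn) _]
    refine ENNReal.sum_ne_top.2 fun n _ => ?_
    exact ((Set.indicator_le_self' (fun _ _ => zero_le) n).trans_lt ENNReal.one_lt_top).ne
  refine ne_top_of_le_ne_top ?_ ((ENNReal.tsum_le_tsum hterm).trans
    (ENNReal.tsum_comp_le_tsum_of_injective Subtype.val_injective
      fun n : ℕ => ENNReal.ofReal (w n) + F.indicator 1 n))
  rw [ENNReal.tsum_add]
  exact ENNReal.add_ne_top.2 ⟨hw.tsum_ofReal_ne_top, hF'⟩

theorem measureReal_compl_iUnion_residueSet_eq_zero {p : ℕ} [Fact p.Prime]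
    [MeasurableSpace ℤ_[p]] [BorelSpace ℤ_[p]]
    (μ : Measure ℤ_[p]) [μ.IsAddHaarMeasure] [IsProbabilityMeasure μ] (S : Set ℕ) (k : ℕ → ℕ)
    (hS : ∀ n ∈ S, p.Coprime n) (hk : ∀ n ∈ S, (p : ℝ) ^ k n ≤ p * n)
    (hdiv : ¬ Summable (S.indicator fun n => (n.totient : ℝ) / (p : ℝ) ^ k n)) (M : ℕ) :
    μ.real {x | ∀ n ≥ M, n ∈ S → ∀ b < n, b.Coprime n →
      x ∉ PadicInt.residueSet p (k n) n b} = 0 := by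
  classical
  have hpp : p.Prime := Fact.out
  set w := S.indicator fun n => (n.totient : ℝ) / (p : ℝ) ^ k n with hw
  set J : ℕ → Finset ℕ := fun n => if n ∈ S then (Finset.range n).filter (·.Coprime n) else ∅
    with hJ
  have hwS : ∀ n ∈ S, w n = (n.totient : ℝ) / (p : ℝ) ^ k n := fun n hn =>
    Set.indicator_of_mem hn _
  have hw0 : ∀ n ∉ S, w n = 0 := fun n hn => Set.indicator_of_notMem hn _
  have hJS : ∀ n ∈ S, J n = (Finset.range n).filter (·.Coprime n) := fun n hn => if_pos hn
  have hJ0 : ∀ n ∉ S, J n = ∅ := fun n hn => if_neg hn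
  have hpos : ∀ n ∈ S, 0 < n := fun n hn => Nat.pos_of_ne_zero fun h0 => by
    have := hS n hn
    rw [h0, Nat.coprime_zero_right] at this
    exact hpp.ne_one this
  obtain ⟨C, hC, hover⟩ := exists_sum_measureReal_inter_residueSet_le μ
  set A := {x | ∀ n ≥ M, n ∈ S → ∀ b < n, b.Coprime n → x ∉ PadicInt.residueSet p (k n) n b}
    with hA
  have hAclosed : IsClosed A := by
    have e : A = (⋃ n, ⋃ (_ : n ≥ M), ⋃ (_ : n ∈ S), ⋃ b, ⋃ (_ : b < n), ⋃ (_ : b.Coprime n),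
        PadicInt.residueSet p (k n) n b)ᶜ := by
      ext x
      simp [hA]
    rw [e, isClosed_compl_iff]
    exact isOpen_iUnion fun n => isOpen_iUnion fun _ => isOpen_iUnion fun _ => isOpen_iUnion fun b =>
      isOpen_iUnion fun _ => isOpen_iUnion fun _ => PadicInt.isOpen_residueSet _ _ _
  refine measureReal_eq_zero_of_quasi_independent μ J
    (fun n b => PadicInt.residueSet p (k n) n b)
    (fun n b => (PadicInt.isOpen_residueSet _ _ _).measurableSet) w
    (Set.indicator_nonneg fun n _ => by positivity) hdiv hC.le ?_ hAclosed.measurableSet (M := M)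
    ?_ (c := 2⁻¹) (by norm_num) ?_
  · intro m n
    by_cases hm : m ∈ S
    · by_cases hn : n ∈ S
      · rw [hJS m hm, hJS n hn, hwS m hm, hwS n hn]
        exact hover k m n (hpos m hm) (hpos n hn) (hS m hm) (hS n hn) (hk m hm) (hk n hn)
      · simp [hJ0 n hn, hw0 n hn]
    · by_cases hmn : m = n
      · subst hmn
        simp [hJ0 m hm, hw0 m hm]
      · simp [hJ0 m hm, hw0 m hm, hmn]
  · intro n hn b hb
    by_cases hnS : n ∈ S
    · rw [hJS n hnS, Finset.mem_filter, Finset.mem_range] at hb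
      exact Set.disjoint_left.2 fun x hx hxA => hxA n hn hnS b hb.1 hb.2 hx
    · simp [hJ0 n hnS] at hb
  · intro ε hε
    obtain ⟨j, hj⟩ := exists_measureReal_preimage_image_diff_lt μ hAclosed hε
    refine ⟨_, Set.subset_preimage_image (PadicInt.toZModPow j) A,
      PadicInt.measurableSet_preimage_toZModPow j _, hj, ?_⟩
    obtain ⟨n₀, hn₀⟩ := eventually_le_sum_measureReal_residueSet_inter μ j
    refine ⟨n₀, fun n hn => ?_⟩
    by_cases hnS : n ∈ S
    swap
    · simp [hJ0 n hnS, hw0 n hnS]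
    have : NeZero (p ^ j) := ⟨pow_ne_zero _ hpp.ne_zero⟩
    have hZ : (PadicInt.toZModPow j : ℤ_[p] → ZMod (p ^ j)) '' A =
        ((PadicInt.toZModPow j '' A).toFinite.toFinset : Set (ZMod (p ^ j))) := by simp
    have hmeas := measureReal_inter_preimage_toZModPow μ MeasurableSet.univ j
      ((PadicInt.toZModPow j '' A).toFinite.toFinset)
    rw [← hZ] at hmeas
    simp only [Set.univ_inter, PadicInt.measureReal_preimage_toZModPow_singleton] at hmeas
    rw [hmeas, hJS n hnS, hwS n hnS, Finset.mul_sum]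
    calc _ ≤ _ := Finset.sum_le_sum fun z _ => hn₀ n hn (hS n hnS) (k n) z
      _ = _ := by
        rw [Finset.sum_comm]
        refine Finset.sum_congr rfl fun b _ => ?_
        rw [hZ, measureReal_inter_preimage_toZModPow μ
          (PadicInt.isOpen_residueSet _ _ _).measurableSet, ← hZ]

/-- **Theorem 4(i) (Haynes).** Let `p` be prime and `ψ` non-negative with
`Σ μ_p(E_n(ψ)) = ∞`.  If the sum of `μ_p(E_n(ψ))` restricted to those `n` with
`ψ(n) ≥ 1/n` already diverges, then `μ_p(W_p(ψ)) = 1`. -/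
theorem stmt3 (p : ℕ) [Fact p.Prime] [MeasurableSpace ℤ_[p]] [BorelSpace ℤ_[p]]
    (μ : Measure ℤ_[p]) [μ.IsAddHaarMeasure] [IsProbabilityMeasure μ]
    (ψ : ℕ → ℝ) (hψ : ∀ n, 0 ≤ ψ n)
    (hdiv : ∑' n : ℕ, μ (padicE p ψ n) = ⊤)
    (hbig : ∑' n : {n : ℕ // 1 / (n : ℝ) ≤ ψ n}, μ (padicE p ψ n) = ⊤) :
    μ (padicW p ψ) = 1 := by
  by_cases hinf : {n | p ∣ n ∧ (padicE p ψ n).Nonempty}.Infinite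
  · have : padicW p ψ = Set.univ := by
      refine Set.eq_univ_of_forall fun x => hinf.mono fun n hn => ?_
      change x ∈ padicE p ψ n
      rw [padicE_eq_univ hn.1 hn.2]
      trivial
    rw [this, measure_univ]
  have hfin := Set.not_infinite.1 hinf
  have hpp : p.Prime := Fact.out
  have hpos : ∀ n, p.Coprime n → 0 < n := fun n hn => Nat.pos_of_ne_zero fun h0 => by
    rw [h0, Nat.coprime_zero_right] at hn
    exact hpp.ne_one hn
  have hex : ∀ n, ∃ k : ℕ, p.Coprime n → 1 / (n : ℝ) ≤ ψ n → ((p : ℝ) ^ k)⁻¹ ≤ ψ n ∧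
      (p : ℝ) ^ k ≤ p * n ∧ ∀ j < k, ψ n < ((p : ℝ) ^ j)⁻¹ := by
    intro n
    by_cases h : p.Coprime n ∧ 1 / (n : ℝ) ≤ ψ n
    · obtain ⟨k, hk⟩ := exists_pow_scale hpp.one_lt (hpos n h.1) h.2
      exact ⟨k, fun _ _ => hk⟩
    · exact ⟨0, fun h1 h2 => absurd ⟨h1, h2⟩ h⟩
  choose k hk using hex
  set S : Set ℕ := {n | p.Coprime n ∧ 1 / (n : ℝ) ≤ ψ n} with hS
  have hns : ¬ Summable (S.indicator fun n => (n.totient : ℝ) / (p : ℝ) ^ k n) := by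
    intro hs
    refine tsum_measure_padicE_ne_top μ (hs.mul_left 3) hfin (fun n h1 h2 => ?_) hbig
    rw [Set.indicator_of_mem (show n ∈ S from ⟨h1, h2⟩)]
    exact measureReal_padicE_le μ (hpos n h1) h1 (hk n h1 h2).2.2
  have hnull : ∀ M, μ {x | ∀ n ≥ M, n ∈ S → ∀ b < n, b.Coprime n →
      x ∉ PadicInt.residueSet p (k n) n b} = 0 := fun M =>
    (measureReal_eq_zero_iff (measure_ne_top _ _)).1
      (measureReal_compl_iUnion_residueSet_eq_zero μ S k (fun n hn => hn.1)
        (fun n hn => (hk n hn.1 hn.2).2.1) hns M)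
  have hae : ∀ᵐ x ∂μ, x ∈ padicW p ψ := by
    refine measure_mono_null (fun x hx => ?_) (measure_iUnion_null hnull)
    obtain ⟨M, hM⟩ := (Set.not_infinite.1 hx).bddAbove
    refine Set.mem_iUnion.2 ⟨M + 1, fun n hn hnS b hb hbn hxb => ?_⟩
    have := hM (residueSet_subset_padicE hnS.1 (hk n hnS.1 hnS.2).1 hb hbn hxb)
    omega
  exact (measure_congr (eventuallyEq_univ.2 hae)).trans measure_univ
end
end

section
/- Let p be a prime and ψ : ℕ → ℝ a non-negative function with Σ_{n∈ℕ} μ_p(E_n(ψ)) = ∞. If there exists γ ∈ ℝ such that the sequence n^{−γ}ψ(n) is non-increasing on ℕ \ pℕ (i.e. for all m, n ∈ ℕ with p ∤ m, p ∤ n and m ≤ n one has m^{−γ}ψ(m) ≥ n^{−γ}ψ(n)), then μ_p(W_p(ψ)) = 1. -/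
open MeasureTheory Filter

noncomputable section

section Volume

variable {p : ℕ} [Fact p.Prime]

theorem PadicInt.dist_natCast_le_pow_iff {k a b : ℕ} :
    dist (a : ℤ_[p]) b ≤ (p : ℝ) ^ (-(k : ℤ)) ↔ a ≡ b [MOD p ^ k] := by
  rw [dist_eq_norm]
  have h : (a : ℤ_[p]) - b = ((a - b : ℤ) : ℤ_[p]) := by push_cast; rfl
  rw [h, PadicInt.norm_int_le_pow_iff_dvd, Nat.ModEq.comm, Nat.modEq_iff_dvd]
  push_cast
  rfl

theorem PadicInt.dist_appr_le (x : ℤ_[p]) (k : ℕ) :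
    dist x (x.appr k) ≤ (p : ℝ) ^ (-(k : ℤ)) := by
  rw [dist_eq_norm, PadicInt.norm_le_pow_iff_mem_span_pow]
  exact PadicInt.appr_spec k x

variable [MeasurableSpace ℤ_[p]] [BorelSpace ℤ_[p]]
  (μ : Measure ℤ_[p]) [μ.IsAddHaarMeasure] [IsProbabilityMeasure μ]

theorem PadicInt.measureReal_closedBall_pow (x : ℤ_[p]) (k : ℕ) :
    μ.real (Metric.closedBall x ((p : ℝ) ^ (-(k : ℤ)))) = (p : ℝ) ^ (-(k : ℤ)) := by
  have hp : 0 < (p : ℝ) := by exact_mod_cast (Fact.out : p.Prime).pos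
  set r : ℝ := (p : ℝ) ^ (-(k : ℤ)) with hr
  have htrans : ∀ y : ℤ_[p], μ.real (Metric.closedBall y r) = μ.real (Metric.closedBall 0 r) := by
    intro y
    have : (y + ·) ⁻¹' Metric.closedBall y r = Metric.closedBall (0 : ℤ_[p]) r := by
      ext z; simp
    rw [measureReal_def, ← measure_preimage_add μ y, this, measureReal_def]
  have hcover : (⋃ i ∈ Finset.range (p ^ k), Metric.closedBall (i : ℤ_[p]) r) = Set.univ := by
    refine Set.eq_univ_of_forall fun y => ?_
    simp only [Set.mem_iUnion, Finset.mem_range, Metric.mem_closedBall]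
    exact ⟨y.appr k, PadicInt.appr_lt y k, PadicInt.dist_appr_le y k⟩
  have hdisj : Set.PairwiseDisjoint (↑(Finset.range (p ^ k)) : Set ℕ)
      fun i : ℕ => Metric.closedBall (i : ℤ_[p]) r := by
    intro i hi j hj hij
    refine Set.disjoint_left.2 fun y hyi hyj => hij ?_
    rw [Metric.mem_closedBall'] at hyi
    rw [Metric.mem_closedBall] at hyj
    have h := (dist_triangle_max (i : ℤ_[p]) y j).trans (max_le hyi hyj)
    rw [PadicInt.dist_natCast_le_pow_iff] at h
    simp only [Finset.coe_range, Set.mem_Iio] at hi hj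
    exact Nat.ModEq.eq_of_lt_of_lt h hi hj
  have hsum := measureReal_biUnion_finset (μ := μ) hdisj fun i _ => measurableSet_closedBall
  rw [hcover, Finset.sum_congr rfl fun (i : ℕ) _ => htrans (i : ℤ_[p]),
    Finset.sum_const, Finset.card_range,
    nsmul_eq_mul, probReal_univ] at hsum
  push_cast at hsum
  rw [htrans, eq_inv_of_mul_eq_one_right hsum.symm, hr, zpow_neg, zpow_natCast]

theorem PadicInt.measureReal_closedBall_le (x : ℤ_[p]) {r : ℝ} (hr : 0 ≤ r) :
    μ.real (Metric.closedBall x r) ≤ r := by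
  have hp : 1 < (p : ℝ) := by exact_mod_cast (Fact.out : p.Prime).one_lt
  rcases le_or_gt 1 r with h1 | h1
  · exact measureReal_le_one.trans h1
  rcases hr.eq_or_lt with rfl | hr
  · refine le_of_forall_pos_le_add fun ε hε => ?_
    obtain ⟨k, hk⟩ := PadicInt.exists_pow_neg_lt p hε
    rw [zero_add]
    refine le_trans ?_ hk.le
    rw [← PadicInt.measureReal_closedBall_pow μ x k]
    exact measureReal_mono (Metric.closedBall_subset_closedBall (by positivity))
  obtain ⟨k, hk1, hk2⟩ := exists_nat_pow_near_of_lt_one hr h1.le (inv_pos.2 (by linarith))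
    (inv_lt_one_of_one_lt₀ hp)
  have hpow : ∀ m : ℕ, (p : ℝ)⁻¹ ^ m = (p : ℝ) ^ (-(m : ℤ)) := fun m => by
    rw [zpow_neg, zpow_natCast, inv_pow]
  rw [hpow] at hk1 hk2
  rcases hk2.eq_or_lt with hk2 | hk2
  · rw [hk2, PadicInt.measureReal_closedBall_pow]
  refine le_trans ?_ hk1.le
  rw [← PadicInt.measureReal_closedBall_pow μ x (k + 1)]
  refine measureReal_mono fun y hy => ?_
  rw [Metric.mem_closedBall, dist_eq_norm] at hy ⊢
  have := (PadicInt.norm_lt_pow_iff_norm_le_pow_sub_one _ _).1 (hy.trans_lt hk2)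
  convert this using 2
  push_cast
  ring

theorem PadicInt.div_le_measureReal_closedBall (x : ℤ_[p]) {r : ℝ} (hr : 0 ≤ r) (hr1 : r ≤ 1) :
    r / p ≤ μ.real (Metric.closedBall x r) := by
  have hp : 1 < (p : ℝ) := by exact_mod_cast (Fact.out : p.Prime).one_lt
  rcases hr.eq_or_lt with rfl | hr
  · simp
  obtain ⟨k, hk1, hk2⟩ := exists_nat_pow_near_of_lt_one hr hr1 (inv_pos.2 (by linarith))
    (inv_lt_one_of_one_lt₀ hp)
  have : r / p ≤ (p : ℝ) ^ (-((k + 1 : ℕ) : ℤ)) := by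
    rw [zpow_neg, zpow_natCast, ← inv_pow, pow_succ, div_eq_mul_inv]
    gcongr
  refine this.trans ?_
  rw [← PadicInt.measureReal_closedBall_pow μ x (k + 1)]
  refine measureReal_mono (Metric.closedBall_subset_closedBall ?_)
  rw [zpow_neg, zpow_natCast, ← inv_pow]
  exact hk1.le

theorem PadicInt.measure_compl_eq_zero_of_forall_closedBall {H : Set ℤ_[p]} (hH : MeasurableSet H)
    {c : ℝ} (hc : 0 < c)
    (h : ∀ x (j : ℕ), c * (p : ℝ) ^ (-(j : ℤ)) ≤
      μ.real (H ∩ Metric.closedBall x ((p : ℝ) ^ (-(j : ℤ))))) :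
    μ Hᶜ = 0 := by
  have hp : 1 < (p : ℝ) := by exact_mod_cast (Fact.out : p.Prime).one_lt
  have : IsUnifLocDoublingMeasure μ := by
    refine ⟨⟨2 * p, ?_⟩⟩
    filter_upwards [Ioc_mem_nhdsGT (zero_lt_one' ℝ)] with ε hε x
    have h1 := PadicInt.measureReal_closedBall_le μ x (r := 2 * ε) (by linarith [hε.1])
    have h2 := PadicInt.div_le_measureReal_closedBall μ x hε.1.le hε.2
    rw [div_le_iff₀ (by linarith)] at h2
    rw [← ofReal_measureReal (μ := μ), ← ofReal_measureReal (μ := μ) (s := Metric.closedBall x ε)]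
    have : ((2 * p : NNReal) : ENNReal) = ENNReal.ofReal (2 * p) := by
      rw [ENNReal.ofReal_mul (by norm_num)]; simp
    rw [this, ← ENNReal.ofReal_mul (by positivity)]
    exact ENNReal.ofReal_le_ofReal (by linarith)
  have hd := IsUnifLocDoublingMeasure.ae_tendsto_measure_inter_div μ Hᶜ 1
  suffices ∀ᵐ x ∂μ.restrict Hᶜ, False by
    rw [← Measure.restrict_eq_zero]
    simpa using this
  filter_upwards [hd] with x hx
  have hlim : Tendsto (fun j : ℕ => (p : ℝ) ^ (-(j : ℤ))) atTop (nhdsWithin 0 (Set.Ioi 0)) := by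
    refine tendsto_nhdsWithin_iff.2 ⟨?_, Eventually.of_forall fun j => ?_⟩
    · simp only [zpow_neg, zpow_natCast, ← inv_pow]
      exact tendsto_pow_atTop_nhds_zero_of_lt_one (by positivity) (inv_lt_one_of_one_lt₀ hp)
    · exact Set.mem_Ioi.2 (by positivity)
  have ht := hx (fun _ => x) _ hlim (Eventually.of_forall fun j => by
    simp only [one_mul, Metric.mem_closedBall, dist_self]; positivity)
  have ht' := (ENNReal.tendsto_toReal ENNReal.one_ne_top).comp ht
  refine absurd (le_of_tendsto' (b := 1 - c) ht' fun j => ?_) (by simp [hc])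
  simp only [Function.comp, ENNReal.toReal_div]
  have hpos : 0 < (p : ℝ) ^ (-(j : ℤ)) := by positivity
  change μ.real _ / μ.real _ ≤ _
  rw [PadicInt.measureReal_closedBall_pow, div_le_iff₀ hpos]
  have h1 := measureReal_inter_add_sdiff (μ := μ)
    (s := Metric.closedBall x ((p : ℝ) ^ (-(j : ℤ)))) hH
  rw [PadicInt.measureReal_closedBall_pow, Set.sdiff_eq, Set.inter_comm, Set.inter_comm _ Hᶜ] at h1
  linarith [h x j]

end Volume

theorem MeasureTheory.sq_sum_measureReal_le {α ι : Type*} [MeasurableSpace α] (μ : Measure α)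
    [IsFiniteMeasure μ] (s : Finset ι) {A : ι → Set α} (hA : ∀ i, MeasurableSet (A i)) :
    (∑ i ∈ s, μ.real (A i)) ^ 2 ≤
      μ.real (⋃ i ∈ s, A i) * ∑ i ∈ s, ∑ k ∈ s, μ.real (A i ∩ A k) := by
  set U := ⋃ i ∈ s, A i with hU
  have hUm : MeasurableSet U := Finset.measurableSet_biUnion s fun i _ => hA i
  have key : ∀ l : ℝ, 0 ≤ μ.real U * (l * l) + (-2 * ∑ i ∈ s, μ.real (A i)) * l +
      ∑ i ∈ s, ∑ k ∈ s, μ.real (A i ∩ A k) := by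
    intro l
    let f : α → ℝ := fun x => ∑ i ∈ s, (A i).indicator 1 x - l * U.indicator 1 x
    have hsq : ∀ x, f x ^ 2 = ∑ i ∈ s, ∑ k ∈ s, (A i ∩ A k).indicator 1 x -
        2 * l * (∑ i ∈ s, (A i).indicator 1 x) + l * l * U.indicator 1 x := by
      intro x
      have h1 : ∀ i ∈ s, (A i).indicator (1 : α → ℝ) x * U.indicator 1 x =
          (A i).indicator 1 x := by
        intro i hi
        by_cases hx : x ∈ A i
        · have : x ∈ U := Set.mem_biUnion hi hx
          simp [hx, this]
        · simp [hx]
      have h2 : U.indicator (1 : α → ℝ) x * U.indicator 1 x = U.indicator 1 x := by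
        by_cases hx : x ∈ U <;> simp [hx]
      have h3 : (∑ i ∈ s, (A i).indicator (1 : α → ℝ) x) * U.indicator 1 x =
          ∑ i ∈ s, (A i).indicator 1 x := by
        rw [Finset.sum_mul]; exact Finset.sum_congr rfl h1
      have h4 : (∑ i ∈ s, (A i).indicator (1 : α → ℝ) x) * ∑ i ∈ s, (A i).indicator 1 x =
          ∑ i ∈ s, ∑ k ∈ s, (A i ∩ A k).indicator 1 x := by
        rw [Finset.sum_mul_sum]
        refine Finset.sum_congr rfl fun i _ => Finset.sum_congr rfl fun k _ => ?_
        rw [Set.inter_indicator_one]; rfl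
      rw [← h4]
      simp only [f]
      linear_combination (-2 * l) * h3 + l ^ 2 * h2
    have hi : ∀ B : Set α, MeasurableSet B → Integrable (B.indicator (1 : α → ℝ)) μ :=
      fun B hB => (integrable_const (1 : ℝ)).indicator hB
    have hint : ∫ x, f x ^ 2 ∂μ = ∑ i ∈ s, ∑ k ∈ s, μ.real (A i ∩ A k) -
        2 * l * (∑ i ∈ s, μ.real (A i)) + l * l * μ.real U := by
      have hI2 : Integrable (fun x => ∑ i ∈ s, (A i).indicator (1 : α → ℝ) x) μ :=
        integrable_finsetSum _ fun i _ => hi _ (hA i)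
      have hI1 : ∀ i, Integrable (fun x => ∑ k ∈ s, (A i ∩ A k).indicator (1 : α → ℝ) x) μ :=
        fun i => integrable_finsetSum _ fun k _ => hi _ ((hA i).inter (hA k))
      have hI3 : Integrable (fun x => ∑ i ∈ s, ∑ k ∈ s, (A i ∩ A k).indicator (1 : α → ℝ) x) μ :=
        integrable_finsetSum _ fun i _ => hI1 i
      simp only [hsq]
      rw [integral_add (f := fun x => _ - _) (hI3.sub (hI2.const_mul _)) ((hi U hUm).const_mul _),
        integral_sub hI3 (hI2.const_mul _), integral_const_mul, integral_const_mul,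
        integral_finsetSum _ fun i _ => hI1 i, integral_finsetSum _ fun i _ => hi _ (hA i),
        integral_indicator_one hUm]
      congr 2
      · refine Finset.sum_congr rfl fun i _ => ?_
        rw [integral_finsetSum _ fun k _ => hi _ ((hA i).inter (hA k))]
        exact Finset.sum_congr rfl fun k _ => integral_indicator_one ((hA i).inter (hA k))
      · congr 1
        exact Finset.sum_congr rfl fun k _ => integral_indicator_one (hA k)
    have := integral_nonneg (μ := μ) (f := fun x => f x ^ 2) fun x => sq_nonneg _
    rw [hint] at this
    linarith
  have := discrim_le_zero key
  rw [discrim] at this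
  linarith

section Fractions

/-- Reduced fractions `a / n` in `[0, 1]` with `n ≤ X` and `p ∤ n`. -/
def fareyPairs (p X : ℕ) : Finset (ℕ × ℕ) :=
  (Finset.range (X + 1) ×ˢ Finset.range (X + 1)).filter
    fun q => q.1 ≤ q.2 ∧ ¬ p ∣ q.2 ∧ q.1.Coprime q.2

theorem mem_fareyPairs {p X : ℕ} {q : ℕ × ℕ} :
    q ∈ fareyPairs p X ↔ q.2 ≤ X ∧ q.1 ≤ q.2 ∧ ¬ p ∣ q.2 ∧ q.1.Coprime q.2 := by
  simp only [fareyPairs, Finset.mem_filter, Finset.mem_product, Finset.mem_range]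
  constructor
  · rintro ⟨⟨_, h⟩, h'⟩
    exact ⟨by omega, h'⟩
  · rintro ⟨h, h'⟩
    exact ⟨⟨by omega, by omega⟩, h'⟩

variable {p : ℕ} [Fact p.Prime]

/-- The fraction `q.1 / q.2` as a `p`-adic integer (junk when `p ∣ q.2`). -/
def padicFrac (p : ℕ) [Fact p.Prime] (q : ℕ × ℕ) : ℤ_[p] :=
  (q.1 : ℤ_[p]) * Ring.inverse (q.2 : ℤ_[p])

theorem norm_natCast_of_not_dvd {n : ℕ} (hn : ¬ p ∣ n) : ‖(n : ℤ_[p])‖ = 1 := by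
  rw [PadicInt.norm_natCast_eq_one_iff]
  exact (Nat.Prime.coprime_iff_not_dvd Fact.out).2 hn

theorem natCast_mul_padicFrac {q : ℕ × ℕ} (hq : ¬ p ∣ q.2) :
    (q.2 : ℤ_[p]) * padicFrac p q = q.1 := by
  rw [padicFrac, mul_left_comm, Ring.mul_inverse_cancel _
    (PadicInt.isUnit_iff.2 (norm_natCast_of_not_dvd hq)), mul_one]

theorem coe_padicFrac {q : ℕ × ℕ} (hq : ¬ p ∣ q.2) :
    (padicFrac p q : ℚ_[p]) = (q.1 : ℚ_[p]) / (q.2 : ℚ_[p]) := by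
  have h0 : (q.2 : ℚ_[p]) ≠ 0 := by
    rw [Nat.cast_ne_zero]
    rintro h
    exact hq (h ▸ dvd_zero p)
  rw [eq_div_iff h0, mul_comm]
  exact_mod_cast congrArg ((↑) : ℤ_[p] → ℚ_[p]) (natCast_mul_padicFrac hq)

theorem dist_padicFrac {q : ℕ × ℕ} (hq : ¬ p ∣ q.2) (x : ℤ_[p]) :
    dist (padicFrac p q) x = dist (q.1 : ℤ_[p]) (q.2 * x) := by
  rw [dist_eq_norm, dist_eq_norm, ← natCast_mul_padicFrac hq, ← mul_sub, norm_mul,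
    norm_natCast_of_not_dvd hq, one_mul]

theorem dist_padicFrac_padicFrac {q q' : ℕ × ℕ} (hq : ¬ p ∣ q.2) (hq' : ¬ p ∣ q'.2) :
    dist (padicFrac p q) (padicFrac p q') =
      dist ((q.1 * q'.2 : ℕ) : ℤ_[p]) ((q'.1 * q.2 : ℕ) : ℤ_[p]) := by
  rw [dist_padicFrac hq, dist_eq_norm, dist_eq_norm]
  push_cast
  rw [← natCast_mul_padicFrac hq', ← one_mul ‖(q.1 : ℤ_[p]) - _‖, ← norm_natCast_of_not_dvd hq',
    ← norm_mul]
  congr 1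
  ring

theorem eq_of_dist_padicFrac_le {X K : ℕ} (hK : X ^ 2 < p ^ K) {q q' : ℕ × ℕ}
    (hq : q ∈ fareyPairs p X) (hq' : q' ∈ fareyPairs p X)
    (h : dist (padicFrac p q) (padicFrac p q') ≤ (p : ℝ) ^ (-(K : ℤ))) : q = q' := by
  rw [mem_fareyPairs] at hq hq'
  obtain ⟨a, n⟩ := q
  obtain ⟨b, m⟩ := q'
  obtain ⟨h1, h2, h3, h4⟩ := hq
  obtain ⟨k1, k2, k3, k4⟩ := hq'
  rw [dist_padicFrac_padicFrac h3 k3, PadicInt.dist_natCast_le_pow_iff] at h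
  simp only at *
  have e : a * m = b * n := by
    refine Nat.ModEq.eq_of_lt_of_lt h (lt_of_le_of_lt ?_ hK) (lt_of_le_of_lt ?_ hK)
    · rw [sq]; exact Nat.mul_le_mul (h2.trans h1) k1
    · rw [sq]; exact Nat.mul_le_mul (k2.trans k1) h1
  have d1 : n ∣ m := h4.symm.dvd_of_dvd_mul_left (e ▸ Dvd.intro_left b rfl)
  have d2 : m ∣ n := k4.symm.dvd_of_dvd_mul_left (e ▸ Dvd.intro_left a rfl)
  obtain rfl := Nat.dvd_antisymm d1 d2
  have : 0 < n := Nat.pos_of_ne_zero fun h => h3 (h ▸ dvd_zero p)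
  rw [Nat.eq_of_mul_eq_mul_right this e]

theorem card_mul_le_of_mem_closedBall {X K : ℕ} (hK : X ^ 2 < p ^ K) {s : Finset (ℕ × ℕ)}
    (hs : s ⊆ fareyPairs p X) {x : ℤ_[p]} {r : ℝ}
    (hx : ∀ q ∈ s, padicFrac p q ∈ Metric.closedBall x r) :
    s.card * (p : ℝ) ^ (-(K : ℤ)) ≤ max r ((p : ℝ) ^ (-(K : ℤ))) := by
  have hp : 0 < (p : ℝ) := by exact_mod_cast (Fact.out : p.Prime).pos
  borelize ℤ_[p]
  let μ : Measure ℤ_[p] := Measure.addHaarMeasure ⊤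
  have : IsProbabilityMeasure μ := ⟨by
    simpa [μ] using Measure.addHaarMeasure_self
      (K₀ := (⊤ : TopologicalSpace.PositiveCompacts ℤ_[p]))⟩
  set δ : ℝ := (p : ℝ) ^ (-(K : ℤ)) with hδ
  have hδ0 : 0 < δ := by positivity
  have hdisj : Set.PairwiseDisjoint (↑s : Set (ℕ × ℕ))
      fun q => Metric.closedBall (padicFrac p q) δ := by
    intro q hq q' hq' hne
    refine Set.disjoint_left.2 fun y hy hy' => hne ?_
    rw [Metric.mem_closedBall'] at hy
    exact eq_of_dist_padicFrac_le hK (hs hq) (hs hq')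
      ((dist_triangle_max _ y _).trans (max_le hy hy'))
  have hsum := measureReal_biUnion_finset (μ := μ) hdisj fun _ _ => measurableSet_closedBall
  rw [Finset.sum_congr rfl fun q _ => PadicInt.measureReal_closedBall_pow μ _ K,
    Finset.sum_const, nsmul_eq_mul] at hsum
  rw [← hsum]
  refine le_trans (measureReal_mono (Set.iUnion₂_subset fun q hq y hy => ?_))
    (PadicInt.measureReal_closedBall_le μ x (hδ0.le.trans (le_max_right r δ)))
  rw [Metric.mem_closedBall] at hy ⊢
  refine (dist_triangle_max _ (padicFrac p q) _).trans ?_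
  rw [max_comm]
  exact max_le_max (hx q hq) hy

open Classical in
theorem card_fareyPairs_closedBall_le {X : ℕ} (hX : X ≠ 0) (x : ℤ_[p]) (j : ℕ) :
    (((fareyPairs p X).filter fun q =>
      padicFrac p q ∈ Metric.closedBall x ((p : ℝ) ^ (-(j : ℤ)))).card : ℝ) ≤
      p * (X : ℝ) ^ 2 * (p : ℝ) ^ (-(j : ℤ)) + 1 := by
  have hp1 : 1 < p := (Fact.out : p.Prime).one_lt
  have hp : 0 < (p : ℝ) := by exact_mod_cast hp1.le
  set K := Nat.log p (X ^ 2) + 1 with hK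
  have h1 : X ^ 2 < p ^ K := Nat.lt_pow_succ_log_self hp1 _
  have h2 : p ^ K ≤ p * X ^ 2 := by
    rw [hK, pow_succ, mul_comm]
    exact Nat.mul_le_mul_left _ (Nat.pow_log_le_self _ (by positivity))
  have h2' : (p : ℝ) ^ K ≤ p * (X : ℝ) ^ 2 := by exact_mod_cast h2
  have h3 := card_mul_le_of_mem_closedBall h1 (Finset.filter_subset _ _)
    (x := x) (r := (p : ℝ) ^ (-(j : ℤ))) fun q hq => (Finset.mem_filter.1 hq).2
  have hpK : (p : ℝ) ^ (-(K : ℤ)) * (p : ℝ) ^ K = 1 := by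
    rw [zpow_neg, zpow_natCast]; exact inv_mul_cancel₀ (by positivity)
  have h4 := mul_le_mul_of_nonneg_right (h3.trans (max_le_add_of_nonneg (by positivity)
    (by positivity))) (by positivity : 0 ≤ (p : ℝ) ^ K)
  rw [mul_assoc, hpK, mul_one, add_mul, hpK] at h4
  refine h4.trans ?_
  rw [mul_comm]
  gcongr

/-- The reduced fractions in `[0, 1]` with denominator prime to `p` and comparable to `p ^ t`. -/
def fareyBlock (p t : ℕ) : Finset (ℕ × ℕ) :=
  (fareyPairs p (p ^ t)).filter fun q => p ^ t ≤ p ^ 7 * q.2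

open Classical in
/-- The fractions of `fareyBlock p t` in the ball of radius `p ^ (-j)` around `x`. -/
def localFareyBlock (x : ℤ_[p]) (j t : ℕ) : Finset (ℕ × ℕ) :=
  (fareyBlock p t).filter fun q => padicFrac p q ∈ Metric.closedBall x ((p : ℝ) ^ (-(j : ℤ)))

open Classical in
theorem localFareyBlock_subset_fareyBlock (x : ℤ_[p]) (j t : ℕ) :
    localFareyBlock x j t ⊆ fareyBlock p t :=
  Finset.filter_subset _ _

open Classical in
theorem localFareyBlock_subset_fareyPairs (x : ℤ_[p]) (j t : ℕ) :
    localFareyBlock x j t ⊆ fareyPairs p (p ^ t) :=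
  (Finset.filter_subset _ _).trans (Finset.filter_subset _ _)

open Classical in
theorem padicFrac_mem_of_mem_localFareyBlock {x : ℤ_[p]} {j t : ℕ} {q : ℕ × ℕ}
    (hq : q ∈ localFareyBlock x j t) :
    padicFrac p q ∈ Metric.closedBall x ((p : ℝ) ^ (-(j : ℤ))) :=
  (Finset.mem_filter.1 hq).2

theorem padicFrac_mul {g : ℕ} {q : ℕ × ℕ} (hg : ¬ p ∣ g) (hq : ¬ p ∣ q.2) :
    padicFrac p (g * q.1, g * q.2) = padicFrac p q := by
  have h : ¬ p ∣ g * q.2 := (Fact.out : p.Prime).not_dvd_mul hg hq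
  have hu := (PadicInt.isUnit_iff.2 (norm_natCast_of_not_dvd h)).mul_left_injective
  refine hu ?_
  change padicFrac p (g * q.1, g * q.2) * ((g * q.2 : ℕ) : ℤ_[p]) =
    padicFrac p q * ((g * q.2 : ℕ) : ℤ_[p])
  have h1 := natCast_mul_padicFrac (p := p) (q := (g * q.1, g * q.2)) h
  have h2 := natCast_mul_padicFrac hq
  rw [mul_comm, h1]
  push_cast
  rw [← h2]
  ring

theorem padicFrac_mem_closedBall_of_modEq {q : ℕ × ℕ} (hq : ¬ p ∣ q.2) {x : ℤ_[p]} {j : ℕ}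
    (h : q.1 ≡ x.appr j * q.2 [MOD p ^ j]) :
    padicFrac p q ∈ Metric.closedBall x ((p : ℝ) ^ (-(j : ℤ))) := by
  rw [Metric.mem_closedBall, dist_padicFrac hq]
  refine (dist_triangle_max _ ((x.appr j * q.2 : ℕ) : ℤ_[p]) _).trans
    (max_le (PadicInt.dist_natCast_le_pow_iff.2 h) ?_)
  push_cast
  rw [mul_comm, dist_eq_norm, ← mul_sub, norm_mul, norm_natCast_of_not_dvd hq, one_mul,
    ← dist_eq_norm, dist_comm]
  exact PadicInt.dist_appr_le x j

open Classical in
theorem pow_le_mul_card_localFareyBlock (x : ℤ_[p]) {j t : ℕ} (ht : j + 6 ≤ t) :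
    (p : ℝ) ^ (2 * t) ≤ (p : ℝ) ^ (11 + j) * (localFareyBlock x j t).card := by
  obtain ⟨s, rfl⟩ := Nat.exists_eq_add_of_le ht
  set t := j + 6 + s with ht'
  have hp2 : 2 ≤ p := (Fact.out : p.Prime).two_le
  have hp : 0 < p := by omega
  have hp2' : (2 : ℝ) ≤ p := by exact_mod_cast hp2
  let R : ℕ → Finset (ℕ × ℕ) := fun X => (fareyPairs p X).filter fun q =>
      padicFrac p q ∈ Metric.closedBall x ((p : ℝ) ^ (-(j : ℤ)))
  let L : ℕ → Finset (ℕ × ℕ) := fun g => if g ≤ p ^ 6 then localFareyBlock x j t else R (p ^ t / g)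
  let φ : ℕ × ℕ → ℕ × ℕ := fun u =>
    (x.appr j * (p * (p ^ (j + 4 + s) + u.1) + 1) % p ^ j + p ^ j * u.2,
      p * (p ^ (j + 4 + s) + u.1) + 1)
  have hcover : (Finset.range (p ^ (j + 4 + s)) ×ˢ Finset.range (p ^ (5 + s))).image φ ⊆
      (Finset.Icc 1 (p ^ t)).biUnion fun g => (L g).image fun q => (g * q.1, g * q.2) := by
    intro q hq
    obtain ⟨⟨k, i⟩, hki, rfl⟩ := Finset.mem_image.1 hq
    simp only [Finset.mem_product, Finset.mem_range] at hki
    obtain ⟨hk, hi⟩ := hki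
    set n := p * (p ^ (j + 4 + s) + k) + 1 with hn
    set a := x.appr j * n % p ^ j + p ^ j * i with ha
    have hφ : φ (k, i) = (a, n) := rfl
    have hpn : ¬ p ∣ n := fun h =>
      (Fact.out : p.Prime).one_lt.ne' (Nat.dvd_one.1 ((Nat.dvd_add_right (dvd_mul_right _ _)).1 h))
    have hnlow : p ^ t ≤ p * n := by
      have : p ^ t = p * (p * p ^ (j + 4 + s)) := by rw [ht']; ring
      rw [this, hn]
      gcongr
      nlinarith
    have hnup : n ≤ p ^ t := by
      have h1 : p ^ t = p * (p * p ^ (j + 4 + s)) := by rw [ht']; ring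
      have h2 : p * (p ^ (j + 4 + s) + k + 1) ≤ p * (p * p ^ (j + 4 + s)) := by
        gcongr
        nlinarith
      rw [h1, hn]
      nlinarith
    have han : a ≤ n := by
      have h1 : x.appr j * n % p ^ j < p ^ j := Nat.mod_lt _ (by positivity)
      have h2 : p ^ j * (i + 1) ≤ p ^ j * p ^ (5 + s) := by gcongr; omega
      have h3 : p ^ j * p ^ (5 + s) = p * p ^ (j + 4 + s) := by ring
      have h4 : p * p ^ (j + 4 + s) ≤ n := by
        rw [hn]
        nlinarith
      rw [h3, mul_add_one] at h2
      rw [ha]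
      linarith
    have hmod : a ≡ x.appr j * n [MOD p ^ j] := by
      rw [ha, Nat.ModEq, Nat.add_mul_mod_self_left, Nat.mod_mod]
    have hball : padicFrac p (a, n) ∈ Metric.closedBall x ((p : ℝ) ^ (-(j : ℤ))) :=
      padicFrac_mem_closedBall_of_modEq hpn hmod
    have hnpos : 0 < n := by omega
    obtain ⟨g, a', n', hg, hcop, ha', hn'⟩ := Nat.exists_coprime' (m := a) (n := n)
      (Nat.gcd_pos_of_pos_right _ hnpos)
    rw [hn'] at hpn hnpos
    have hpg : ¬ p ∣ g := fun h => hpn (h.mul_left _)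
    have hpn' : ¬ p ∣ n' := fun h => hpn (h.mul_right _)
    have hn'pos : 0 < n' := Nat.pos_of_mul_pos_right hnpos
    rw [hφ]
    refine Finset.mem_biUnion.2 ⟨g, Finset.mem_Icc.2 ⟨hg, ?_⟩,
      Finset.mem_image.2 ⟨(a', n'), ?_, ?_⟩⟩
    · exact le_trans (Nat.le_mul_of_pos_left g hn'pos) (hn' ▸ hnup)
    · rw [ha', hn', mul_comm a', mul_comm n', padicFrac_mul (q := (a', n')) hpg hpn'] at hball
      have ha'n' : a' ≤ n' := by
        rw [ha', hn'] at han
        exact Nat.le_of_mul_le_mul_right han hg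
      have hn'up : n' ≤ p ^ t / g := (Nat.le_div_iff_mul_le hg).2 (hn' ▸ hnup)
      simp only [L]
      split_ifs with hg6
      · refine Finset.mem_filter.2 ⟨Finset.mem_filter.2 ⟨mem_fareyPairs.2
          ⟨hn'up.trans (Nat.div_le_self _ _), ha'n', hpn', hcop⟩, hnlow.trans ?_⟩, hball⟩
        change p * n ≤ p ^ 7 * n'
        rw [hn']
        calc p * (n' * g) ≤ p * (n' * p ^ 6) := by gcongr
          _ = p ^ 7 * n' := by ring
      · exact Finset.mem_filter.2 ⟨mem_fareyPairs.2 ⟨hn'up, ha'n', hpn', hcop⟩, hball⟩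
    · rw [ha', hn', mul_comm a', mul_comm n']
  have hφinj : Function.Injective φ := by
    rintro ⟨k, i⟩ ⟨k', i'⟩ h
    simp only [φ, Prod.mk.injEq] at h
    have hk : k = k' := by
      have := Nat.eq_of_mul_eq_mul_left hp (Nat.add_right_cancel h.2)
      omega
    subst hk
    have := Nat.eq_of_mul_eq_mul_left (Nat.pow_pos hp) (Nat.add_left_cancel h.1)
    rw [this]
  have hcard : p ^ (j + 4 + s) * p ^ (5 + s) ≤ ∑ g ∈ Finset.Icc 1 (p ^ t), (L g).card := by
    have := (Finset.card_le_card hcover).trans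
      (Finset.card_biUnion_le.trans (Finset.sum_le_sum fun g _ => Finset.card_image_le))
    rwa [Finset.card_image_of_injective _ hφinj, Finset.card_product, Finset.card_range,
      Finset.card_range] at this
  have h6t : p ^ 6 ≤ p ^ t := Nat.pow_le_pow_right hp (by omega)
  have hsplit : Finset.Icc 1 (p ^ t) = Finset.Ioc 0 (p ^ 6) ∪ Finset.Ioc (p ^ 6) (p ^ t) := by
    rw [Finset.Ioc_union_Ioc_eq_Ioc (Nat.zero_le _) h6t]; rfl
  have hdisj : Disjoint (Finset.Ioc 0 (p ^ 6)) (Finset.Ioc (p ^ 6) (p ^ t)) :=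
    Finset.Ioc_disjoint_Ioc_of_le le_rfl
  rw [hsplit, Finset.sum_union hdisj] at hcard
  have hsmall : ∑ g ∈ Finset.Ioc 0 (p ^ 6), (L g).card = p ^ 6 * (localFareyBlock x j t).card := by
    rw [Finset.sum_congr rfl fun g hg => by
      rw [show L g = localFareyBlock x j t from if_pos (Finset.mem_Ioc.1 hg).2]]
    simp
  have hlarge : ((∑ g ∈ Finset.Ioc (p ^ 6) (p ^ t), (L g).card : ℕ) : ℝ) ≤
      2 * (p : ℝ) ^ (j + 7 + 2 * s) := by
    push_cast
    calc ∑ g ∈ Finset.Ioc (p ^ 6) (p ^ t), ((L g).card : ℝ)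
        ≤ ∑ g ∈ Finset.Ioc (p ^ 6) (p ^ t),
          ((p : ℝ) ^ (j + 13 + 2 * s) * ((g : ℝ) ^ 2)⁻¹ + 1) := by
          refine Finset.sum_le_sum fun g hg => ?_
          obtain ⟨hg1, hg2⟩ := Finset.mem_Ioc.1 hg
          have hg0 : 0 < g := by omega
          rw [show L g = R (p ^ t / g) from if_neg (by omega)]
          refine (card_fareyPairs_closedBall_le (Nat.div_pos hg2 hg0).ne' x j).trans ?_
          have h1 : ((p ^ t / g : ℕ) : ℝ) ≤ (p : ℝ) ^ t / g := by
            exact_mod_cast (Nat.cast_div_le (α := ℝ) (m := p ^ t) (n := g))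
          have h2 : (p : ℝ) ^ (j + 13 + 2 * s) * ((g : ℝ) ^ 2)⁻¹ =
              p * ((p : ℝ) ^ t / g) ^ 2 * (p : ℝ) ^ (-(j : ℤ)) := by
            rw [zpow_neg, zpow_natCast, ht']
            field_simp
            ring
          rw [h2]
          gcongr
      _ ≤ (p : ℝ) ^ (j + 13 + 2 * s) * ((p : ℝ) ^ 6)⁻¹ + (p : ℝ) ^ t := by
          rw [Finset.sum_add_distrib, ← Finset.mul_sum]
          have h1 := sum_Ioc_inv_sq_le_sub (α := ℝ) (k := p ^ 6) (n := p ^ t) (by positivity) h6t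
          push_cast at h1
          have h2 : (0 : ℝ) ≤ ((p : ℝ) ^ t)⁻¹ := by positivity
          gcongr
          · linarith
          · simp only [Finset.sum_const, Nat.card_Ioc, nsmul_eq_mul, mul_one]
            exact_mod_cast Nat.sub_le _ _
      _ ≤ 2 * (p : ℝ) ^ (j + 7 + 2 * s) := by
          have h1 : (p : ℝ) ^ (j + 13 + 2 * s) * ((p : ℝ) ^ 6)⁻¹ = (p : ℝ) ^ (j + 7 + 2 * s) := by
            rw [show j + 13 + 2 * s = j + 7 + 2 * s + 6 by ring, pow_add]
            exact mul_inv_cancel_right₀ (by positivity) _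
          have h2 : (p : ℝ) ^ t ≤ (p : ℝ) ^ (j + 7 + 2 * s) :=
            pow_le_pow_right₀ (by linarith) (by omega)
          linarith
  have hcard' : (p : ℝ) ^ (j + 4 + s) * (p : ℝ) ^ (5 + s) ≤
      (p : ℝ) ^ 6 * (localFareyBlock x j t).card + 2 * (p : ℝ) ^ (j + 7 + 2 * s) := by
    refine le_trans ?_ (add_le_add_right hlarge _)
    rw [hsmall] at hcard
    exact_mod_cast hcard
  have hy : (p : ℝ) ^ (j + 4 + s) * (p : ℝ) ^ (5 + s) =
      (p : ℝ) ^ 2 * (p : ℝ) ^ (j + 7 + 2 * s) := by ring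
  have hy0 : (0 : ℝ) < (p : ℝ) ^ (j + 7 + 2 * s) := by positivity
  have hmain : (p : ℝ) ^ (j + 7 + 2 * s) ≤ (p : ℝ) ^ 6 * (localFareyBlock x j t).card := by
    have h4 : 0 ≤ ((p : ℝ) ^ 2 - 4) * (p : ℝ) ^ (j + 7 + 2 * s) :=
      mul_nonneg (by nlinarith) hy0.le
    rw [hy] at hcard'
    linarith
  calc (p : ℝ) ^ (2 * t) = (p : ℝ) ^ (5 + j) * (p : ℝ) ^ (j + 7 + 2 * s) := by rw [ht']; ring
    _ ≤ (p : ℝ) ^ (5 + j) * ((p : ℝ) ^ 6 * (localFareyBlock x j t).card) := by gcongr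
    _ = _ := by ring

end Fractions

section LimsupSet

theorem sq_pow_lt_pow (p t : ℕ) [Fact p.Prime] : (p ^ t) ^ 2 < p ^ (2 * t + 1) := by
  rw [← pow_mul, mul_comm]
  exact Nat.pow_lt_pow_right (Fact.out : p.Prime).one_lt (Nat.lt_succ_self _)

theorem card_localFareyBlock_le {p : ℕ} [Fact p.Prime] (x : ℤ_[p]) {j t : ℕ} (hj : j ≤ t) :
    ((localFareyBlock x j t).card : ℝ) ≤ (p : ℝ) ^ (-(j : ℤ)) * (p : ℝ) ^ (2 * t + 1) := by
  have hp : 1 < (p : ℝ) := by exact_mod_cast (Fact.out : p.Prime).one_lt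
  have h := card_mul_le_of_mem_closedBall (sq_pow_lt_pow p t)
    (localFareyBlock_subset_fareyPairs x j t) fun q => padicFrac_mem_of_mem_localFareyBlock
  rw [max_eq_left (zpow_le_zpow_right₀ hp.le (by omega)), zpow_neg, zpow_natCast,
    ← div_eq_mul_inv, div_le_iff₀ (by positivity)] at h
  exact h

theorem sum_ite_half_pow_le (I : Finset ℕ) (t : ℕ) {v : ℝ} (hv : 0 ≤ v) :
    ∑ s ∈ I, (if s ≤ t then (1 / 2 : ℝ) ^ (t - s) * v else 0) ≤ 2 * v := by
  rw [← Finset.sum_filter, ← Finset.sum_mul]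
  refine mul_le_mul_of_nonneg_right ?_ hv
  calc ∑ s ∈ I.filter (· ≤ t), (1 / 2 : ℝ) ^ (t - s)
      ≤ ∑ s ∈ Finset.range (t + 1), (1 / 2 : ℝ) ^ (t - s) :=
        Finset.sum_le_sum_of_subset_of_nonneg
          (fun s hs => Finset.mem_range.2 (Nat.lt_succ_of_le (Finset.mem_filter.1 hs).2))
          fun _ _ _ => by positivity
    _ = ∑ s ∈ Finset.range (t + 1), (1 / 2 : ℝ) ^ s := by
        rw [← Finset.sum_range_reflect]
        refine Finset.sum_congr rfl fun s hs => ?_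
        have := Finset.mem_range.1 hs
        congr 1
        omega
    _ ≤ 2 := sum_geometric_two_le _

variable {p : ℕ} [Fact p.Prime] [MeasurableSpace ℤ_[p]] [BorelSpace ℤ_[p]]
  (μ : Measure ℤ_[p]) [μ.IsAddHaarMeasure] [IsProbabilityMeasure μ]
  {r : ℕ → ℝ}

open Classical in
theorem sum_measureReal_inter_le (hr0 : ∀ t, 0 ≤ r t)
    (hr1 : ∀ t, r t ≤ (p : ℝ) ^ (-((2 * t + 1 : ℕ) : ℤ))) (x : ℤ_[p]) {j s t : ℕ} (hj : j ≤ s) :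
    ∑ q ∈ localFareyBlock x j s, ∑ q' ∈ localFareyBlock x j t,
      μ.real (Metric.closedBall (padicFrac p q) (r s) ∩ Metric.closedBall (padicFrac p q') (r t)) ≤
    (p : ℝ) ^ (-(j : ℤ)) * (p : ℝ) ^ (2 * s + 1) * ((r s * (p : ℝ) ^ (2 * t + 1) + 1) * r t) := by
  have hp : 0 < (p : ℝ) := by exact_mod_cast (Fact.out : p.Prime).pos
  have key : ∀ q : ℕ × ℕ, ∑ q' ∈ localFareyBlock x j t, μ.real
      (Metric.closedBall (padicFrac p q) (r s) ∩ Metric.closedBall (padicFrac p q') (r t)) ≤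
      (r s * (p : ℝ) ^ (2 * t + 1) + 1) * r t := by
    intro q
    set D := (localFareyBlock x j t).filter fun q' =>
      padicFrac p q' ∈ Metric.closedBall (padicFrac p q) (max (r t) (r s)) with hD
    have hcard : (D.card : ℝ) ≤ r s * (p : ℝ) ^ (2 * t + 1) + 1 := by
      have h := card_mul_le_of_mem_closedBall (s := D) (sq_pow_lt_pow p t)
        ((Finset.filter_subset _ _).trans (localFareyBlock_subset_fareyPairs x j t))
        fun q' hq' => (Finset.mem_filter.1 hq').2
      have h2 : max (max (r t) (r s)) ((p : ℝ) ^ (-((2 * t + 1 : ℕ) : ℤ))) ≤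
          r s + (p : ℝ) ^ (-((2 * t + 1 : ℕ) : ℤ)) := by
        have h3 := hr0 s
        have h4 := hr1 t
        have h5 : (0 : ℝ) < (p : ℝ) ^ (-((2 * t + 1 : ℕ) : ℤ)) := by positivity
        refine max_le (max_le ?_ ?_) ?_ <;> linarith
      have h3 := h.trans h2
      rw [zpow_neg, zpow_natCast, ← div_eq_mul_inv, div_le_iff₀ (by positivity), add_mul,
        inv_mul_cancel₀ (by positivity)] at h3
      exact h3
    calc _ ≤ ∑ q' ∈ localFareyBlock x j t,
          (if padicFrac p q' ∈ Metric.closedBall (padicFrac p q) (max (r t) (r s))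
            then r t else 0) := by
          refine Finset.sum_le_sum fun q' _ => ?_
          split_ifs with h
          · exact (measureReal_mono Set.inter_subset_right).trans
              (PadicInt.measureReal_closedBall_le μ _ (hr0 t))
          · have hempty : Metric.closedBall (padicFrac p q) (r s) ∩
                Metric.closedBall (padicFrac p q') (r t) = ∅ :=
              Set.eq_empty_of_forall_notMem fun y hy => h <| (dist_triangle_max _ y _).trans
                (max_le_max (Metric.mem_closedBall'.1 hy.2) hy.1)
            rw [hempty, measureReal_empty]
      _ = D.card * r t := by
          rw [← Finset.sum_filter, Finset.sum_const, nsmul_eq_mul]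
      _ ≤ _ := mul_le_mul_of_nonneg_right hcard (hr0 t)
  have hnonneg : 0 ≤ (r s * (p : ℝ) ^ (2 * t + 1) + 1) * r t :=
    mul_nonneg (add_nonneg (mul_nonneg (hr0 s) (by positivity)) zero_le_one) (hr0 t)
  refine (Finset.sum_le_card_nsmul _ _ _ fun q _ => key q).trans ?_
  rw [nsmul_eq_mul]
  exact mul_le_mul_of_nonneg_right (card_localFareyBlock_le x hj) hnonneg

theorem le_measureReal_biUnion_localFareyBlock (hr0 : ∀ t, 0 ≤ r t)
    (hr1 : ∀ t, r t ≤ (p : ℝ) ^ (-((2 * t + 1 : ℕ) : ℤ))) (x : ℤ_[p]) {j : ℕ} {I : Finset ℕ}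
    (hI : ∀ t ∈ I, j + 6 ≤ t) (hV : 1 ≤ ∑ t ∈ I, (p : ℝ) ^ (2 * t) * r t) :
    1 / (5 * (p : ℝ) ^ 26) * (p : ℝ) ^ (-(j : ℤ)) ≤ μ.real (⋃ u ∈ I.sigma (localFareyBlock x j),
      Metric.closedBall (padicFrac p u.2) (r u.1)) := by
  have hp2 : 2 ≤ (p : ℝ) := by exact_mod_cast (Fact.out : p.Prime).two_le
  have hp : 0 < (p : ℝ) := by linarith
  set V := ∑ t ∈ I, (p : ℝ) ^ (2 * t) * r t with hVdef
  have hKS := sq_sum_measureReal_le μ (I.sigma (localFareyBlock x j))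
    (A := fun u => Metric.closedBall (padicFrac p u.2) (r u.1)) fun u => measurableSet_closedBall
  set m := μ.real (⋃ u ∈ I.sigma (localFareyBlock x j),
      Metric.closedBall (padicFrac p u.2) (r u.1)) with hm
  set P : ℝ := (p : ℝ) ^ (-(j : ℤ)) with hP
  have hP0 : 0 < P := by positivity
  have hfirst : P / (p : ℝ) ^ 12 * V ≤ ∑ u ∈ I.sigma (localFareyBlock x j),
      μ.real (Metric.closedBall (padicFrac p u.2) (r u.1)) := by
    rw [Finset.sum_sigma, hVdef, Finset.mul_sum]
    refine Finset.sum_le_sum fun t ht => ?_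
    have hr1' : r t ≤ 1 := (hr1 t).trans (zpow_le_one_of_nonpos₀ (by linarith) (by omega))
    refine le_trans ?_ (Finset.card_nsmul_le_sum _ _ _ fun q _ =>
      PadicInt.div_le_measureReal_closedBall μ _ (hr0 t) hr1')
    rw [nsmul_eq_mul]
    have h1 := mul_le_mul_of_nonneg_right (pow_le_mul_card_localFareyBlock x (hI t ht)) (hr0 t)
    have h2 := mul_le_mul_of_nonneg_left h1 (by positivity : 0 ≤ P / (p : ℝ) ^ 12)
    refine h2.trans (le_of_eq ?_)
    rw [hP, zpow_neg, zpow_natCast]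
    field_simp
    ring
  let M : ℕ → ℕ → ℝ := fun s t => ∑ q ∈ localFareyBlock x j s, ∑ q' ∈ localFareyBlock x j t,
      μ.real (Metric.closedBall (padicFrac p q) (r s) ∩ Metric.closedBall (padicFrac p q') (r t))
  let v : ℕ → ℝ := fun t => (p : ℝ) ^ (2 * t) * r t
  have hv : ∀ t, 0 ≤ v t := fun t => mul_nonneg (by positivity) (hr0 t)
  let w : ℕ → ℕ → ℝ := fun s t => if s ≤ t then (1 / 2 : ℝ) ^ (t - s) * v t else 0
  have hw : ∀ s t, 0 ≤ w s t := fun s t => by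
    simp only [w]
    split_ifs
    · exact mul_nonneg (by positivity) (hv t)
    · exact le_rfl
  have hMle : ∀ s ∈ I, ∀ t, s ≤ t →
      M s t ≤ P * ((p : ℝ) ^ 2 * (v s * v t) + p * w s t) := by
    intro s hs t hst
    refine (sum_measureReal_inter_le μ hr0 hr1 x (by linarith [hI s hs])).trans ?_
    have h1 : (p : ℝ) ^ (2 * s) * r t ≤ w s t := by
      obtain ⟨d, rfl⟩ := Nat.exists_eq_add_of_le hst
      simp only [w, v, if_pos hst, Nat.add_sub_cancel_left]
      rw [← mul_assoc]
      refine mul_le_mul_of_nonneg_right ?_ (hr0 _)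
      rw [mul_add, pow_add, mul_left_comm, pow_mul (p : ℝ) 2 d, ← mul_pow]
      refine le_mul_of_one_le_right (by positivity) (one_le_pow₀ ?_)
      nlinarith
    calc _ = P * ((p : ℝ) ^ 2 * (v s * v t) + p * ((p : ℝ) ^ (2 * s) * r t)) := by
          simp only [v]
          ring
      _ ≤ _ := by gcongr
  have hMsymm : ∀ s t, M s t = M t s := by
    intro s t
    simp only [M]
    rw [Finset.sum_comm]
    simp only [Set.inter_comm]
  have hMle' : ∀ s ∈ I, ∀ t ∈ I,
      M s t ≤ P * ((p : ℝ) ^ 2 * (v s * v t) + p * (w s t + w t s)) := by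
    intro s hs t ht
    rcases le_total s t with h | h
    · refine (hMle s hs t h).trans ?_
      have := hw t s
      gcongr
      linarith
    · rw [hMsymm]
      refine (hMle t ht s h).trans ?_
      have := hw s t
      rw [mul_comm (v s)]
      gcongr
      linarith
  have hsecond : ∑ u ∈ I.sigma (localFareyBlock x j), ∑ u' ∈ I.sigma (localFareyBlock x j),
      μ.real (Metric.closedBall (padicFrac p u.2) (r u.1) ∩
        Metric.closedBall (padicFrac p u'.2) (r u'.1)) ≤ P * (5 * (p : ℝ) ^ 2 * V ^ 2) := by
    calc _ = ∑ s ∈ I, ∑ t ∈ I, M s t := by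
          simp only [Finset.sum_sigma, M]
          exact Finset.sum_congr rfl fun s _ => Finset.sum_comm
      _ ≤ ∑ s ∈ I, ∑ t ∈ I, P * ((p : ℝ) ^ 2 * (v s * v t) + p * (w s t + w t s)) :=
          Finset.sum_le_sum fun s hs => Finset.sum_le_sum fun t ht => hMle' s hs t ht
      _ = P * ((p : ℝ) ^ 2 * V ^ 2 + p * (2 * ∑ t ∈ I, ∑ s ∈ I, w s t)) := by
          have h1 : ∑ s ∈ I, ∑ t ∈ I, w s t = ∑ t ∈ I, ∑ s ∈ I, w s t := Finset.sum_comm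
          have h2 : ∑ s ∈ I, ∑ t ∈ I, v s * v t = V ^ 2 := by rw [sq, ← Finset.sum_mul_sum]
          have h3 : ∑ s ∈ I, ∑ t ∈ I, P * ((p : ℝ) ^ 2 * (v s * v t) + p * (w s t + w t s)) =
              P * ((p : ℝ) ^ 2 * ∑ s ∈ I, ∑ t ∈ I, v s * v t +
                p * (∑ s ∈ I, ∑ t ∈ I, w s t + ∑ s ∈ I, ∑ t ∈ I, w t s)) := by
            simp only [Finset.mul_sum, Finset.sum_add_distrib, mul_add]
          rw [h3, h2, h1, two_mul]
      _ ≤ P * ((p : ℝ) ^ 2 * V ^ 2 + p * (2 * (2 * V))) := by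
          gcongr
          rw [hVdef, Finset.mul_sum]
          exact Finset.sum_le_sum fun t _ => sum_ite_half_pow_le I t (hv t)
      _ ≤ _ := by
          gcongr
          nlinarith [mul_le_mul hp2 hV zero_le_one hp.le, mul_pos hp (by linarith : 0 < V)]
  have hm0 : 0 ≤ m := measureReal_nonneg
  have hV0 : 0 < V := by linarith
  have h1 : (P / (p : ℝ) ^ 12 * V) ^ 2 ≤ m * (P * (5 * (p : ℝ) ^ 2 * V ^ 2)) :=
    (pow_le_pow_left₀ (by positivity) hfirst 2).trans
      (hKS.trans (mul_le_mul_of_nonneg_left hsecond hm0))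
  have h2 : (P / (p : ℝ) ^ 12 * V) ^ 2 =
      (1 / (5 * (p : ℝ) ^ 26) * P) * (P * (5 * (p : ℝ) ^ 2 * V ^ 2)) := by
    field_simp
  rw [h2] at h1
  exact le_of_mul_le_mul_right h1 (by positivity)

theorem measure_compl_biUnion_fareyBlock (hr0 : ∀ t, 0 ≤ r t)
    (hr1 : ∀ t, r t ≤ (p : ℝ) ^ (-((2 * t + 1 : ℕ) : ℤ)))
    (hdiv : ¬ Summable fun t => (p : ℝ) ^ (2 * t) * r t)
    (t₀ : ℕ) : μ (⋃ t ≥ t₀, ⋃ q ∈ fareyBlock p t,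
      Metric.closedBall (padicFrac p q) (r t))ᶜ = 0 := by
  have hp1 : 1 < (p : ℝ) := by exact_mod_cast (Fact.out : p.Prime).one_lt
  refine PadicInt.measure_compl_eq_zero_of_forall_closedBall μ
    (MeasurableSet.iUnion fun t => MeasurableSet.iUnion fun _ =>
      Finset.measurableSet_biUnion _ fun q _ => measurableSet_closedBall)
    (c := 1 / (5 * (p : ℝ) ^ 26)) (by positivity) fun x j => ?_
  set t₁ := max t₀ (j + 6) with ht₁
  have hv : ∀ t, 0 ≤ (p : ℝ) ^ (2 * t) * r t := fun t => mul_nonneg (by positivity) (hr0 t)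
  obtain ⟨T, hT⟩ : ∃ T, 1 ≤ ∑ t ∈ Finset.Ico t₁ T, (p : ℝ) ^ (2 * t) * r t := by
    have h := (not_summable_iff_tendsto_nat_atTop_of_nonneg hv).1 hdiv
    obtain ⟨T, hT1, hT2⟩ := ((h.eventually_ge_atTop
      (∑ t ∈ Finset.range t₁, (p : ℝ) ^ (2 * t) * r t + 1)).and (eventually_ge_atTop t₁)).exists
    refine ⟨T, ?_⟩
    rw [Finset.sum_Ico_eq_sub _ hT2]
    linarith
  refine (le_measureReal_biUnion_localFareyBlock μ hr0 hr1 x (I := Finset.Ico t₁ T)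
    (fun t ht => (le_max_right _ _).trans (Finset.mem_Ico.1 ht).1) hT).trans
    (measureReal_mono (Set.iUnion₂_subset ?_))
  rintro ⟨t, q⟩ hu y hy
  obtain ⟨ht, hq⟩ := Finset.mem_sigma.1 hu
  have ht' : t₁ ≤ t := (Finset.mem_Ico.1 ht).1
  refine ⟨Set.mem_iUnion₂.2 ⟨t, (le_max_left _ _).trans ht', Set.mem_iUnion₂.2
    ⟨q, localFareyBlock_subset_fareyBlock x j t hq, hy⟩⟩, ?_⟩
  refine (dist_triangle_max _ (padicFrac p q) _).trans (max_le (hy.trans ((hr1 t).trans ?_))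
    (padicFrac_mem_of_mem_localFareyBlock hq))
  exact zpow_le_zpow_right₀ hp1.le (by have := (le_max_right t₀ (j + 6)).trans ht'; omega)

end LimsupSet

section Khinchin

theorem pow_add_one_le_of_not_dvd {p t m : ℕ} (ht : t ≠ 0) (hm : ¬ p ∣ m) (h : p ^ t ≤ m) :
    p ^ t + 1 ≤ m :=
  Nat.lt_of_le_of_ne h fun h' => hm (h' ▸ dvd_pow_self p ht)

theorem le_rpow_mul_of_rpow_mul_le {p : ℕ} {ψ : ℕ → ℝ} {γ : ℝ}
    (hmono : ∀ m n : ℕ, ¬ p ∣ m → ¬ p ∣ n → m ≤ n →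
      (n : ℝ) ^ (-γ) * ψ n ≤ (m : ℝ) ^ (-γ) * ψ m) (hψ : ∀ n, 0 ≤ ψ n)
    {B : ℝ} {m n : ℕ} (hm : ¬ p ∣ m) (hn : ¬ p ∣ n) (hmn : m ≤ n) (hB : (n : ℝ) ≤ B * m) :
    ψ n ≤ B ^ |γ| * ψ m := by
  have hm0 : 0 < (m : ℝ) := Nat.cast_pos.2 (Nat.pos_of_ne_zero fun h => hm (h ▸ dvd_zero p))
  have hmn' : (m : ℝ) ≤ n := Nat.cast_le.2 hmn
  have hn0 : 0 < (n : ℝ) := hm0.trans_le hmn'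
  have h := mul_le_mul_of_nonneg_left (hmono m n hm hn hmn) (Real.rpow_nonneg hn0.le γ)
  rw [← mul_assoc, ← mul_assoc, ← Real.rpow_add hn0, add_neg_cancel, Real.rpow_zero, one_mul,
    Real.rpow_neg hm0.le, ← div_eq_mul_inv, ← Real.div_rpow hn0.le hm0.le] at h
  refine h.trans (mul_le_mul_of_nonneg_right ?_ (hψ m))
  exact (Real.rpow_le_rpow_of_exponent_le ((one_le_div hm0).2 hmn') (le_abs_self γ)).trans
    (Real.rpow_le_rpow (by positivity) ((div_le_iff₀ hm0).2 hB) (abs_nonneg γ))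

variable {p : ℕ} [Fact p.Prime] {ψ : ℕ → ℝ}

theorem padicE_eq_univ_of_dvd {n : ℕ} (hn : p ∣ n) (h : (padicE p ψ n).Nonempty) :
    padicE p ψ n = Set.univ := by
  obtain ⟨x, a, ha, hcop, hx⟩ := h
  refine Set.eq_univ_of_forall fun y => ⟨a, ha, hcop, le_trans ?_ hx⟩
  have hn0 : n ≠ 0 := by
    rintro rfl
    rw [Nat.cast_zero, abs_nonpos_iff] at ha
    simp [ha] at hcop
  have hpa : ¬ (p : ℤ) ∣ a := fun hpa => (Fact.out : p.Prime).one_lt.ne'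
    (Nat.dvd_one.1 (hcop ▸ Int.dvd_gcd hpa (Int.natCast_dvd_natCast.2 hn)))
  have hnorma : ‖(a : ℚ_[p])‖ = 1 :=
    (Padic.norm_int_le_one a).antisymm (not_lt.1 fun h => hpa ((Padic.norm_intCast_lt_one_iff).1 h))
  have hnormn : ‖(n : ℚ_[p])‖ < 1 := Padic.norm_natCast_lt_one_iff.2 hn
  have hlarge : 1 < ‖(a : ℚ_[p]) / (n : ℚ_[p])‖ := by
    rw [norm_div, hnorma]
    exact (one_lt_div (norm_pos_iff.2 (Nat.cast_ne_zero.2 hn0))).2 hnormn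
  have hnorm : ∀ z : ℤ_[p], ‖(z : ℚ_[p]) - (a : ℚ_[p]) / (n : ℚ_[p])‖ =
      ‖(a : ℚ_[p]) / (n : ℚ_[p])‖ := by
    intro z
    have hz : ‖(z : ℚ_[p])‖ < ‖(a : ℚ_[p]) / (n : ℚ_[p])‖ :=
      (PadicInt.norm_le_one z).trans_lt hlarge
    rw [sub_eq_add_neg, Padic.add_eq_max_of_ne (by rw [norm_neg]; exact hz.ne), norm_neg,
      max_eq_right hz.le]
  rw [hnorm, hnorm]

theorem mem_padicE_of_dist_padicFrac_le {q : ℕ × ℕ} (hle : q.1 ≤ q.2) (hq : ¬ p ∣ q.2)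
    (hcop : q.1.Coprime q.2) {x : ℤ_[p]} (hx : dist x (padicFrac p q) ≤ ψ q.2) :
    x ∈ padicE p ψ q.2 := by
  rw [dist_eq_norm, PadicInt.norm_def, PadicInt.coe_sub, coe_padicFrac hq] at hx
  exact ⟨q.1, by simpa using hle, by simpa using hcop, by rwa [Int.cast_natCast]⟩

theorem not_dvd_pow_add_one {t : ℕ} (ht : t ≠ 0) : ¬ p ∣ p ^ t + 1 := fun h =>
  (Fact.out : p.Prime).one_lt.ne' (Nat.dvd_one.1 ((Nat.dvd_add_right (dvd_pow_self p ht)).1 h))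

variable [MeasurableSpace ℤ_[p]] [BorelSpace ℤ_[p]]
  (μ : Measure ℤ_[p]) [μ.IsAddHaarMeasure] [IsProbabilityMeasure μ]

theorem measureReal_padicE_le_s5 {n : ℕ} (hn : ¬ p ∣ n) (hψ : 0 ≤ ψ n) :
    μ.real (padicE p ψ n) ≤ (2 * n + 1) * ψ n := by
  have hsub : padicE p ψ n ⊆ ⋃ a ∈ Finset.Icc (-n : ℤ) n,
      Metric.closedBall ((a : ℤ_[p]) * Ring.inverse (n : ℤ_[p])) (ψ n) := by
    rintro x ⟨a, ha, -, hx⟩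
    refine Set.mem_iUnion₂.2 ⟨a, Finset.mem_Icc.2 (abs_le.1 ha), ?_⟩
    have hinv : ((Ring.inverse (n : ℤ_[p]) : ℤ_[p]) : ℚ_[p]) = (n : ℚ_[p])⁻¹ := by
      refine eq_inv_of_mul_eq_one_left ?_
      have := Ring.inverse_mul_cancel _ (PadicInt.isUnit_iff.2 (norm_natCast_of_not_dvd hn))
      exact_mod_cast congrArg ((↑) : ℤ_[p] → ℚ_[p]) this
    rw [Metric.mem_closedBall, dist_eq_norm, PadicInt.norm_def]
    push_cast
    rwa [hinv, ← div_eq_mul_inv]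
  refine (measureReal_mono hsub (measure_ne_top _ _)).trans
    ((measureReal_biUnion_finset_le _ _).trans ?_)
  refine (Finset.sum_le_card_nsmul _ _ _
    fun a _ => PadicInt.measureReal_closedBall_le μ _ hψ).trans (le_of_eq ?_)
  rw [nsmul_eq_mul, Int.card_Icc]
  congr 1
  have : ((n : ℤ) + 1 - -n).toNat = 2 * n + 1 := by omega
  rw [this]
  push_cast
  rfl

/-- The radius attached to the `t`-th block of denominators. -/
def blockRadius (p : ℕ) (ψ : ℕ → ℝ) (C : ℝ) (t : ℕ) : ℝ :=
  if t = 0 then 0 else min (ψ (p ^ t + 1) / C) ((p : ℝ) ^ (-((2 * t + 1 : ℕ) : ℤ)))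

theorem not_summable_blockRadius {C : ℝ} (hC : 0 < C) (hψ : ∀ n, 0 ≤ ψ n)
    (hgrowth : ∀ m n : ℕ, ¬ p ∣ m → ¬ p ∣ n → m ≤ n → n ≤ p ^ 8 * m → ψ n ≤ C * ψ m)
    (hfin : ∀ᶠ n in atTop, p ∣ n → padicE p ψ n = ∅)
    (hdiv : ¬ Summable fun n => μ.real (padicE p ψ n)) :
    ¬ Summable fun t => (p : ℝ) ^ (2 * t) * blockRadius p ψ C t := by
  intro hsum
  refine hdiv ?_
  have hp1 : 1 < p := (Fact.out : p.Prime).one_lt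
  have hp : 1 < (p : ℝ) := by exact_mod_cast hp1
  have hp0 : 0 < (p : ℝ) := by linarith
  set v := fun t => (p : ℝ) ^ (2 * t) * blockRadius p ψ C t with hv
  have hv0 : ∀ t, 0 ≤ v t := fun t => by
    refine mul_nonneg (by positivity) ?_
    rw [blockRadius]
    split_ifs
    · exact le_rfl
    · exact le_min (div_nonneg (hψ _) hC.le) (by positivity)
  obtain ⟨N, hN⟩ := eventually_atTop.1 hfin
  obtain ⟨T, hT⟩ := eventually_atTop.1 (hsum.tendsto_atTop_zero.eventually_lt_const
    (inv_pos.2 hp0))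
  set T₀ := max (max T N) 1 with hT₀
  have hblock : ∀ t ≥ T₀, ∑ m ∈ Finset.Ico (p ^ t) (p ^ (t + 1)), μ.real (padicE p ψ m) ≤
      3 * (p : ℝ) ^ 2 * C ^ 2 * v t := by
    intro t ht
    have ht0 : t ≠ 0 := by omega
    have hrad : ψ (p ^ t + 1) = C * blockRadius p ψ C t := by
      have h1 := hT t (by omega)
      simp only [hv, blockRadius, if_neg ht0] at h1 ⊢
      rcases le_total (ψ (p ^ t + 1) / C) ((p : ℝ) ^ (-((2 * t + 1 : ℕ) : ℤ))) with h2 | h2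
      · rw [min_eq_left h2]
        field_simp
      · rw [min_eq_right h2, zpow_neg, zpow_natCast, pow_succ, mul_inv,
          mul_inv_cancel_left₀ (by positivity)] at h1
        exact absurd h1 (lt_irrefl _)
    have hterm : ∀ m ∈ Finset.Ico (p ^ t) (p ^ (t + 1)), μ.real (padicE p ψ m) ≤
        3 * (p : ℝ) ^ (t + 1) * (C * ψ (p ^ t + 1)) := by
      intro m hm
      obtain ⟨hm1, hm2⟩ := Finset.mem_Ico.1 hm
      by_cases hpm : p ∣ m
      · rw [hN m (by have := (Nat.lt_pow_self hp1 : t < p ^ t); omega) hpm, measureReal_empty]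
        have := hψ (p ^ t + 1)
        positivity
      · refine (measureReal_padicE_le_s5 μ hpm (hψ m)).trans ?_
        have h1 : p ^ t + 1 ≤ m := pow_add_one_le_of_not_dvd ht0 hpm hm1
        have h2 : m ≤ p ^ 8 * (p ^ t + 1) := by
          calc m ≤ p ^ 1 * p ^ t := by rw [← pow_add, add_comm]; exact hm2.le
            _ ≤ p ^ 8 * (p ^ t + 1) :=
              Nat.mul_le_mul (Nat.pow_le_pow_right hp1.le (by norm_num)) (Nat.le_succ _)
        have h3 : (m : ℝ) + 1 ≤ (p : ℝ) ^ (t + 1) := by exact_mod_cast hm2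
        have h4 := hgrowth _ _ (not_dvd_pow_add_one ht0) hpm h1 h2
        exact mul_le_mul (by linarith) h4 (hψ m) (by positivity)
    refine (Finset.sum_le_card_nsmul _ _ _ hterm).trans ?_
    have hcard : ((Finset.Ico (p ^ t) (p ^ (t + 1))).card : ℝ) ≤ (p : ℝ) ^ (t + 1) := by
      rw [Nat.card_Ico]
      exact_mod_cast Nat.sub_le _ _
    rw [nsmul_eq_mul]
    calc _ ≤ (p : ℝ) ^ (t + 1) * (3 * (p : ℝ) ^ (t + 1) * (C * ψ (p ^ t + 1))) :=
          mul_le_mul_of_nonneg_right hcard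
            (mul_nonneg (by positivity) (mul_nonneg hC.le (hψ _)))
      _ = _ := by
        rw [hrad, hv]
        ring
  have hpartial : ∀ n, ∑ m ∈ Finset.range (p ^ (T₀ + n)), μ.real (padicE p ψ m) ≤
      ∑ m ∈ Finset.range (p ^ T₀), μ.real (padicE p ψ m) +
        3 * (p : ℝ) ^ 2 * C ^ 2 * ∑ t ∈ Finset.range n, v (T₀ + t) := by
    intro n
    induction n with
    | zero => simp
    | succ n ih =>
      have h1 := hblock (T₀ + n) (Nat.le_add_right _ _)
      rw [Finset.sum_Ico_eq_sub _ (Nat.pow_le_pow_right hp1.le (Nat.le_succ _))] at h1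
      rw [Finset.sum_range_succ, mul_add, ← add_assoc T₀ n 1]
      linarith
  refine summable_of_sum_range_le (c := ∑ m ∈ Finset.range (p ^ T₀), μ.real (padicE p ψ m) +
        3 * (p : ℝ) ^ 2 * C ^ 2 * ∑' t, v (T₀ + t)) (fun _ => measureReal_nonneg) fun n => ?_
  have hle : n ≤ p ^ (T₀ + n) := (Nat.le_add_left n T₀).trans (Nat.lt_pow_self hp1).le
  refine (Finset.sum_le_sum_of_subset_of_nonneg (Finset.range_subset_range.2 hle)
    fun _ _ _ => measureReal_nonneg).trans ((hpartial n).trans ?_)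
  gcongr
  exact (hsum.comp_injective (add_right_injective T₀)).sum_le_tsum _ fun t _ => hv0 _

theorem measure_padicW_of_growth {C : ℝ} (hC : 0 < C) (hψ : ∀ n, 0 ≤ ψ n)
    (hgrowth : ∀ m n : ℕ, ¬ p ∣ m → ¬ p ∣ n → m ≤ n → n ≤ p ^ 8 * m → ψ n ≤ C * ψ m)
    (hfin : ∀ᶠ n in atTop, p ∣ n → padicE p ψ n = ∅)
    (hdiv : ¬ Summable fun n => μ.real (padicE p ψ n)) :
    μ (padicW p ψ) = 1 := by
  have hp1 : 1 < p := (Fact.out : p.Prime).one_lt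
  have hp0 : 0 < (p : ℝ) := by exact_mod_cast hp1.le
  have hr0 : ∀ t, 0 ≤ blockRadius p ψ C t := fun t => by
    rw [blockRadius]
    split_ifs
    · exact le_rfl
    · exact le_min (div_nonneg (hψ _) hC.le) (by positivity)
  have hr1 : ∀ t, blockRadius p ψ C t ≤ (p : ℝ) ^ (-((2 * t + 1 : ℕ) : ℤ)) := fun t => by
    rw [blockRadius]
    split_ifs
    · positivity
    · exact min_le_right _ _
  have hlarge := ae_all_iff.2 fun t₀ => measure_eq_zero_iff_ae_notMem.1
    (measure_compl_biUnion_fareyBlock μ hr0 hr1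
      (not_summable_blockRadius μ hC hψ hgrowth hfin hdiv) t₀)
  have hW : padicW p ψ =ᵐ[μ] Set.univ := by
    rw [eventuallyEq_univ]
    filter_upwards [hlarge] with x hx
    refine Set.infinite_of_not_bddAbove fun ⟨b, hb⟩ => ?_
    have hx' := Set.notMem_compl_iff.1 (hx (7 + (b + 1)))
    simp only [Set.mem_iUnion] at hx'
    obtain ⟨t, ht, q, hq, hxq⟩ := hx'
    obtain ⟨hq', hqt⟩ := Finset.mem_filter.1 hq
    obtain ⟨h1, h2, h3, h4⟩ := mem_fareyPairs.1 hq'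
    have hψq : blockRadius p ψ C t ≤ ψ q.2 := by
      have ht0 : t ≠ 0 := by omega
      rw [blockRadius, if_neg ht0]
      refine (min_le_left _ _).trans ((div_le_iff₀' hC).2 ?_)
      refine hgrowth _ _ h3 (not_dvd_pow_add_one ht0) (h1.trans (Nat.le_succ _)) ?_
      have h5 : 1 ≤ p ^ t := Nat.one_le_pow _ _ hp1.le
      calc p ^ t + 1 ≤ p * p ^ t := by nlinarith
        _ ≤ p * (p ^ 7 * q.2) := Nat.mul_le_mul_left _ hqt
        _ = p ^ 8 * q.2 := by ring
    have hmem : q.2 ≤ b := hb (mem_padicE_of_dist_padicFrac_le h2 h3 h4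
      ((Metric.mem_closedBall.1 hxq).trans hψq))
    have h6 : p ^ 7 * p ^ (b + 1) ≤ p ^ 7 * q.2 := by
      rw [← pow_add]
      exact (Nat.pow_le_pow_right hp1.le ht).trans hqt
    have h7 := Nat.le_of_mul_le_mul_left h6 (Nat.pow_pos (by omega))
    have h8 : b + 1 < p ^ (b + 1) := Nat.lt_pow_self hp1
    omega
  rw [measure_congr hW, measure_univ]

end Khinchin

/-- **Theorem 4(iii) (Haynes).** Let `p` be prime and `ψ` non-negative with
`Σ μ_p(E_n(ψ)) = ∞`.  If for some `γ ∈ ℝ` the sequence `n^(-γ)ψ(n)` is non-increasing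
on `ℕ \ pℕ`, then `μ_p(W_p(ψ)) = 1`. -/
theorem stmt5 (p : ℕ) [Fact p.Prime] [MeasurableSpace ℤ_[p]] [BorelSpace ℤ_[p]]
    (μ : Measure ℤ_[p]) [μ.IsAddHaarMeasure] [IsProbabilityMeasure μ]
    (ψ : ℕ → ℝ) (hψ : ∀ n, 0 ≤ ψ n)
    (hdiv : ∑' n : ℕ, μ (padicE p ψ n) = ⊤)
    (hmono : ∃ γ : ℝ, ∀ m n : ℕ, ¬ p ∣ m → ¬ p ∣ n → m ≤ n →
      (n : ℝ) ^ (-γ) * ψ n ≤ (m : ℝ) ^ (-γ) * ψ m) :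
    μ (padicW p ψ) = 1 := by
  obtain ⟨γ, hγ⟩ := hmono
  by_cases hfin : ∀ᶠ n in atTop, p ∣ n → padicE p ψ n = ∅
  · have hp0 : 0 < (p : ℝ) := by exact_mod_cast (Fact.out : p.Prime).pos
    refine measure_padicW_of_growth μ (C := ((p : ℝ) ^ 8) ^ |γ|) (by positivity) hψ
      (fun m n hm hn hmn hB => le_rpow_mul_of_rpow_mul_le hγ hψ hm hn hmn (by exact_mod_cast hB))
      hfin fun hsum => hsum.tsum_ofReal_ne_top ?_
    simpa only [ofReal_measureReal (measure_ne_top μ _)] using hdiv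
  · have hW : padicW p ψ = Set.univ := by
      refine Set.eq_univ_of_forall fun x => (Nat.frequently_atTop_iff_infinite.1
        (not_eventually.1 hfin)).mono ?_
      intro n hn
      obtain ⟨hpn, hne⟩ := Classical.not_imp.1 hn
      exact (padicE_eq_univ_of_dvd hpn (Set.nonempty_iff_ne_empty.2 hne)).ge (Set.mem_univ x)
    rw [hW, measure_univ]
end
end
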